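/- arXiv:2412.16550 — 2 statements merged into one kernel-verified Lean document; each statement's English description precedes it below -/
import Mathlib

section
/- Let K = ℂ(x₁,…,xₙ) and let Ω be an (n−1)-form with coefficients in K. If there exists an elementary extension L of K together with a Prelle–Singer relation for Ω over L (elements v ∈ L, u₁,…,u_m ∈ L∖{0}, constants c₁,…,c_m ∈ ℂ with (Σᵢ cᵢ duᵢ/uᵢ + dv) ∧ Ω = 0 and Σᵢ cᵢ duᵢ/uᵢ + dv ≠ 0), then there exists a finite algebraic extension L̃ of K contained in L together with elements ṽ ∈ L̃, ũ₁,…,ũ_{m̃} ∈ L̃∖{0} and constants c̃ᵢ ∈ ℂ forming a Prelle–Singer relation for Ω over L̃. -/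
noncomputable section

variable {U : Type} [Field U] [CharZero U] [Algebra ℂ U]

/-- `j`-th coefficient of the one-form  Σᵢ cᵢ duᵢ/uᵢ + dv. -/
def psCoeff {N : ℕ} (D : Fin N → Derivation ℚ U U) {m : ℕ}
    (c u : Fin m → U) (v : U) (j : Fin N) : U :=
  (∑ i, c i * (D j (u i) / u i)) + D j v

/-- Prelle–Singer relation for the (N−1)-form Ω with coefficients `P`:
`(Σᵢ cᵢ duᵢ/uᵢ + dv) ∧ Ω = 0` (the scalar equation `Σⱼ (−1)^j Pⱼ·(coeff j) = 0`)
and `Σᵢ cᵢ duᵢ/uᵢ + dv ≠ 0`. -/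
def IsPSRel {N : ℕ} (D : Fin N → Derivation ℚ U U) (P : Fin N → U) {m : ℕ}
    (c u : Fin m → U) (v : U) : Prop :=
  (∀ i, u i ≠ 0) ∧
  (∑ j : Fin N, (-1 : U) ^ (j : ℕ) * P j * psCoeff D c u v j) = 0 ∧
  (∃ j, psCoeff D c u v j ≠ 0)

/-- One step of an elementary tower: adjoining an exponential, a logarithm, or an
algebraic element. -/
inductive ElemStep {N : ℕ} (D : Fin N → Derivation ℚ U U) :
    IntermediateField ℂ U → IntermediateField ℂ U → Prop
  | exp (F : IntermediateField ℂ U) (t R : U) (hR : R ∈ F) (ht : t ≠ 0)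
      (h : ∀ j, D j t = t * D j R) :
      ElemStep D F (IntermediateField.adjoin ℂ (↑F ∪ {t}))
  | log (F : IntermediateField ℂ U) (t R : U) (hR : R ∈ F) (hR0 : R ≠ 0)
      (h : ∀ j, D j t = D j R / R) :
      ElemStep D F (IntermediateField.adjoin ℂ (↑F ∪ {t}))
  | alg (F : IntermediateField ℂ U) (t : U) (h : IsAlgebraic F t) :
      ElemStep D F (IntermediateField.adjoin ℂ (↑F ∪ {t}))

/-- `F` is an elementary extension of `K`: it is reached from `K` by a finite tower of
elementary steps and has the same constants as `K`. -/
def IsElementary {N : ℕ} (D : Fin N → Derivation ℚ U U)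
    (K F : IntermediateField ℂ U) : Prop :=
  Relation.ReflTransGen (ElemStep D) K F ∧
  ∀ a ∈ F, (∀ j, D j a = 0) → a ∈ K

section Auxiliary

open Polynomial IntermediateField

open scoped IntermediateField.algebraAdjoinAdjoin in
theorem exists_derivation_eq_one {k A : Type*} [Field k] [Field A] [CharZero A] [Algebra k A]
    {t : A} (ht : Transcendental k t) :
    ∃ δ : Derivation ℚ A A, (∀ a : k, δ (algebraMap k A a) = 0) ∧ δ t = 1 := by
  classical
  have : CharZero k := (algebraMap k A).charZero
  obtain ⟨B, htB, hB⟩ := exists_isTranscendenceBasis_superset (R := k) (A := A) (s := {t})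
    ((algebraicIndependent_singleton_iff (R := k) (x := fun i : ({t} : Set A) => (i : A)) ⟨t, rfl⟩).2 ht)
  let v : B → A := (↑)
  let S := Algebra.adjoin k (Set.range v)
  let L := IntermediateField.adjoin k (Set.range v)
  let M := MvPolynomial B k
  have : Algebra.IsAlgebraic L A := hB.isAlgebraic_field
  let : Algebra M S := (hB.1.aevalEquiv : M ≃ₐ[k] S).toAlgHom.toRingHom.toAlgebra
  let : Algebra M L := ((algebraMap S L).comp (algebraMap M S)).toAlgebra
  let : Algebra M A := (MvPolynomial.aeval v : M →ₐ[k] A).toRingHom.toAlgebra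
  have hMA (p : M) : algebraMap M A p = MvPolynomial.aeval v p := rfl
  have : IsScalarTower M S L := .of_algebraMap_eq fun _ => rfl
  have : IsScalarTower k M A := .of_algebraMap_eq fun a =>
    ((MvPolynomial.aeval v : M →ₐ[k] A).commutes a).symm
  have : IsScalarTower M L A := .of_algebraMap_eq fun p => by
    rw [hMA]
    exact (hB.1.algebraMap_aevalEquiv p).symm
  have : Algebra.FormallyEtale M S := .of_equiv
    (AlgEquiv.ofRingEquiv (f := (hB.1.aevalEquiv : M ≃ₐ[k] S).toRingEquiv) (fun _ => rfl) : M ≃ₐ[M] S)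
  have : Algebra.FormallyEtale S L := .of_isLocalization (nonZeroDivisors _)
  have : Algebra.FormallyEtale M L := .comp _ S _
  have : Algebra.FormallyEtale L A := .of_isSeparable L A
  have : Algebra.FormallyEtale M A := .comp _ L _
  let d₀ : Derivation k M A := MvPolynomial.mkDerivation k (Pi.single ⟨t, htB rfl⟩ 1)
  let f : TensorProduct M A (Ω[M⁄k]) →ₗ[A] A :=
    (LinearMap.liftBaseChange A d₀.liftKaehlerDifferential)
  let e := KaehlerDifferential.tensorKaehlerEquivOfFormallyEtale k M A
  let δ : Derivation k A A := (f ∘ₗ e.symm.toLinearMap).compDer (KaehlerDifferential.D k A)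
  have hδ (p : M) : δ (algebraMap M A p) = d₀ p := by
    change f (e.symm (KaehlerDifferential.D k A (algebraMap M A p))) = _
    rw [KaehlerDifferential.tensorKaehlerEquivOfFormallyEtale_symm_D_algebraMap]
    simp [f]
  refine ⟨δ.restrictScalars ℚ, fun a => δ.map_algebraMap a, ?_⟩
  have h := hδ (MvPolynomial.X ⟨t, htB rfl⟩)
  rw [hMA, MvPolynomial.aeval_X] at h
  exact h.trans ((MvPolynomial.mkDerivation_X k _ _).trans (Pi.single_eq_same _ _))

section DerivationLemmas

variable {k A : Type*} [Field k] [Field A] [CharZero k] [Algebra k A]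

/-- The derivation of `k[X]` applying `d` to the coefficients and sending `X` to `v`. -/
def polyDer (d : Derivation ℚ k k) (v : k[X]) : Derivation ℚ k[X] k[X] :=
  PolynomialModule.equivPolynomialSelf.compDer d.mapCoeffs + v • derivative'.restrictScalars ℚ

theorem coeff_polyDer_zero (d : Derivation ℚ k k) (p : k[X]) (i : ℕ) :
    (polyDer d 0 p).coeff i = d (p.coeff i) := by
  simp [polyDer]
  rfl

theorem polyDer_eq (d : Derivation ℚ k k) (v p : k[X]) :
    polyDer d v p = polyDer d 0 p + v * derivative p := by
  simp [polyDer]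

theorem aeval_derivative_minpoly_ne_zero {x : A} (hx : IsAlgebraic k x) :
    aeval x (derivative (minpoly k x)) ≠ 0 :=
  (minpoly.irreducible hx.isIntegral).separable.aeval_derivative_ne_zero (minpoly.aeval k x)

variable [CharZero A]

theorem der_aeval {d : Derivation ℚ k k} {δ : Derivation ℚ A A}
    (h : ∀ a, δ (algebraMap k A a) = algebraMap k A (d a)) (x : A) (p : k[X]) :
    δ (aeval x p) = aeval x (polyDer d 0 p) + aeval x (derivative p) * δ x := by
  induction p using Polynomial.induction_on' with
  | add p q hp hq => simp only [map_add, hp, hq]; ring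
  | monomial n a =>
    have : polyDer d 0 (monomial n a) = monomial n (d a) := by
      ext i
      rw [coeff_polyDer_zero, coeff_monomial, coeff_monomial]
      split_ifs <;> simp
    rw [this]
    simp only [aeval_monomial, derivative_monomial, Derivation.leibniz, Derivation.leibniz_pow,
      smul_eq_mul, h, nsmul_eq_mul, map_mul, map_natCast]
    ring

theorem der_aeval_of_der_eq {d : Derivation ℚ k k} {δ : Derivation ℚ A A}
    (h : ∀ a, δ (algebraMap k A a) = algebraMap k A (d a)) {x : A} {v : k[X]}
    (hv : δ x = aeval x v) (p : k[X]) :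
    δ (aeval x p) = aeval x (polyDer d v p) := by
  rw [der_aeval h, polyDer_eq d v, map_add, map_mul, hv, mul_comm]

theorem der_aeval_of_const {δ : Derivation ℚ A A} (h : ∀ a, δ (algebraMap k A a) = 0) (x : A)
    (p : k[X]) : δ (aeval x p) = aeval x (derivative p) * δ x := by
  have h0 : polyDer (0 : Derivation ℚ k k) 0 p = 0 := by
    ext i; rw [coeff_polyDer_zero]; simp
  simpa [h0] using der_aeval (d := 0) (by simpa using h) x p

theorem der_eq_zero_of_isAlgebraic {δ : Derivation ℚ A A} (h : ∀ a, δ (algebraMap k A a) = 0)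
    {x : A} (hx : IsAlgebraic k x) : δ x = 0 := by
  have := der_aeval_of_const h x (minpoly k x)
  rw [minpoly.aeval, map_zero, zero_eq_mul] at this
  exact this.resolve_left (aeval_derivative_minpoly_ne_zero hx)

theorem der_mem_adjoin {d : Derivation ℚ k k} {δ : Derivation ℚ A A}
    (h : ∀ a, δ (algebraMap k A a) = algebraMap k A (d a)) {x : A} (hx : IsAlgebraic k x) :
    δ x ∈ k⟮x⟯ := by
  have h1 := der_aeval h x (minpoly k x)
  rw [minpoly.aeval, map_zero] at h1
  have h2 := aeval_derivative_minpoly_ne_zero hx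
  have h3 : δ x = -(aeval x (polyDer d 0 (minpoly k x))) / aeval x (derivative (minpoly k x)) := by
    rw [eq_div_iff h2]; linear_combination -h1
  rw [h3]
  have hm (p : k[X]) : aeval x p ∈ k⟮x⟯ :=
    algebra_adjoin_le_adjoin _ _ (aeval_mem_adjoin_singleton k x)
  exact div_mem (neg_mem (hm _)) (hm _)

/-- Two derivations agreeing on `k` and on `t` agree on everything algebraic over `k(t)`. -/
theorem der_eq_of_isAlgebraic_adjoin {δ ε : Derivation ℚ A A}
    (h : ∀ a, δ (algebraMap k A a) = ε (algebraMap k A a)) {S : Set A}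
    (hS : ∀ t ∈ S, δ t = ε t) {x : A} (hx : IsAlgebraic (IntermediateField.adjoin k S) x) :
    δ x = ε x := by
  have h0 : ∀ a : IntermediateField.adjoin k S, (δ - ε) (algebraMap _ A a) = 0 := by
    rintro ⟨a, ha⟩
    change (δ - ε) a = 0
    induction ha using IntermediateField.adjoin_induction with
    | mem x hx => simp [hS x hx]
    | algebraMap a => simp [h a]
    | add x y _ _ hx hy => rw [map_add, hx, hy, add_zero]
    | mul x y _ _ hx hy => rw [Derivation.leibniz, hx, hy]; simp
    | inv x _ hx => rw [Derivation.leibniz_inv, hx]; simp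
  exact sub_eq_zero.1 (der_eq_zero_of_isAlgebraic h0 hx)

theorem isAlgebraic_adjoin_swap {s t : A} (ht : IsAlgebraic k⟮t⟯ s) (hs : Transcendental k s) :
    IsAlgebraic k⟮s⟯ t := by
  by_contra hts
  obtain ⟨δ, hδ, hδt⟩ := exists_derivation_eq_one (k := k⟮s⟯) hts
  obtain ⟨ε, hε, hεs⟩ := exists_derivation_eq_one hs
  have hδk (a : k) : δ (algebraMap k A a) = 0 := hδ (algebraMap k k⟮s⟯ a)
  have hδs : δ s = 0 := hδ ⟨s, mem_adjoin_simple_self k s⟩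
  have : ε s = (ε t • δ) s := der_eq_of_isAlgebraic_adjoin (k := k) (S := {t})
    (fun a => by simp [hε, hδk]) (by simp [hδt]) ht
  simp [hεs, hδs] at this

theorem isAlgebraic_of_der_eq_zero {t x : A} {δ : Derivation ℚ A A}
    (hδ : ∀ a, δ (algebraMap k A a) = 0) (ht : δ t ≠ 0)
    (hx : IsAlgebraic k⟮t⟯ x) (h : δ x = 0) : IsAlgebraic k x := by
  by_contra hxk
  obtain ⟨ε, hε, hεs⟩ := exists_derivation_eq_one hxk
  have : ε x = ((ε t / δ t) • δ) x := der_eq_of_isAlgebraic_adjoin (k := k) (S := {t})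
    (fun a => by simp [hε, hδ]) (by simp [ht]) hx
  simp [h, hεs] at this

end DerivationLemmas

section Residue

variable {k A : Type*} [Field k] [Field A] [Algebra k A]

/-- The local ring at the origin of the field `k(s)`. -/
def localRing (k : Type*) {A : Type*} [Field k] [Field A] [Algebra k A] (s : A) :
    Subalgebra k A where
  carrier := {z | ∃ f h : k[X], h.coeff 0 ≠ 0 ∧ z * aeval s h = aeval s f}
  mul_mem' := by
    rintro a b ⟨f, h, hh, e⟩ ⟨f', h', hh', e'⟩
    exact ⟨f * f', h * h', by simp [mul_coeff_zero, hh, hh'], by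
      rw [map_mul, map_mul, ← e, ← e']; ring⟩
  add_mem' := by
    rintro a b ⟨f, h, hh, e⟩ ⟨f', h', hh', e'⟩
    exact ⟨f * h' + f' * h, h * h', by simp [mul_coeff_zero, hh, hh'], by
      simp only [map_mul, map_add]; rw [← e, ← e']; ring⟩
  algebraMap_mem' a := ⟨C a, 1, by simp, by simp⟩

theorem aeval_mem_localRing (s : A) (f : k[X]) : aeval s f ∈ localRing k s :=
  ⟨f, 1, by simp, by simp⟩

variable {s : A}

theorem aeval_ne_zero_of_transcendental (hs : Transcendental k s) {f : k[X]} (hf : f ≠ 0) : aeval s f ≠ 0 :=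
  fun h => hf ((transcendental_iff.1 hs) f h)

theorem inv_aeval_mem_localRing (hs : Transcendental k s) {f : k[X]} (hf : f.coeff 0 ≠ 0) :
    (aeval s f)⁻¹ ∈ localRing k s :=
  ⟨1, f, hf, by
    rw [map_one, inv_mul_cancel₀]
    exact aeval_ne_zero_of_transcendental hs (by rintro rfl; simp at hf)⟩

theorem coeff_zero_eq_zero_of_aeval_eq_mul (hs : Transcendental k s) {f : k[X]} {z : A} (hz : z ∈ localRing k s)
    (h : aeval s f = s * z) : f.coeff 0 = 0 := by
  obtain ⟨p, q, hq, e⟩ := hz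
  have : f * q = X * p := by
    apply (transcendental_iff_injective.1 hs)
    simp only [map_mul, aeval_X, h, ← e]; ring
  have := congrArg (coeff · 0) this
  simpa [mul_coeff_zero, hq] using this

theorem eq_zero_of_algebraMap_eq_mul (hs : Transcendental k s) {a : k} {z : A} (hz : z ∈ localRing k s)
    (h : algebraMap k A a = s * z) : a = 0 := by
  simpa using coeff_zero_eq_zero_of_aeval_eq_mul hs (f := C a) hz (by simpa using h)

theorem exists_eq_zpow_mul (hs : Transcendental k s) {z : A} (hz : z ∈ k⟮s⟯) (h0 : z ≠ 0) :
    ∃ (n : ℤ) (f h : k[X]), f.coeff 0 ≠ 0 ∧ h.coeff 0 ≠ 0 ∧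
      z = s ^ n * (aeval s f / aeval s h) := by
  have key (p : k[X]) (hp : p ≠ 0) : ∃ (n : ℕ) (f : k[X]), f.coeff 0 ≠ 0 ∧ p = X ^ n * f := by
    obtain ⟨q, hq, hq'⟩ := exists_eq_pow_rootMultiplicity_mul_and_not_dvd p hp 0
    refine ⟨_, q, ?_, by simpa using hq⟩
    rwa [map_zero, sub_zero, X_dvd_iff] at hq'
  obtain ⟨p, q, rfl⟩ := (mem_adjoin_simple_iff k z).1 hz
  have hp : p ≠ 0 := by rintro rfl; simp at h0
  have hq : q ≠ 0 := by rintro rfl; simp at h0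
  obtain ⟨n, f, hf, rfl⟩ := key p hp
  obtain ⟨m, h, hh, rfl⟩ := key q hq
  have hs0 : s ≠ 0 := fun h => hs (h ▸ isAlgebraic_zero)
  refine ⟨n - m, f, h, hf, hh, ?_⟩
  have := aeval_ne_zero_of_transcendental hs (f := h) (by rintro rfl; simp at hh)
  rw [zpow_sub₀ hs0]
  simp
  field_simp

theorem der_zpow_mul (hs : Transcendental k s) [CharZero A] {δ : Derivation ℚ A A} (hδs : δ s = 1) (n : ℤ) (z : A) :
    s * δ (s ^ n * z) = s ^ n * (n * z + s * δ z) := by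
  have hs0 : s ≠ 0 := fun h => hs (h ▸ isAlgebraic_zero)
  rw [Derivation.leibniz, Derivation.leibniz_zpow, hδs]
  simp only [smul_eq_mul, zsmul_eq_mul, mul_one]
  rw [zpow_sub_one₀ hs0]
  field_simp
  ring

variable [CharZero k] [CharZero A] {δ : Derivation ℚ A A}

theorem der_mem_localRing (hs : Transcendental k s)
    (hδ : ∀ a, δ (algebraMap k A a) = 0) (hδs : δ s = 1)
    {z : A} (hz : z ∈ localRing k s) : δ z ∈ localRing k s := by
  obtain ⟨f, h, hh, e⟩ := hz
  have hh0 := aeval_ne_zero_of_transcendental hs (f := h) (by rintro rfl; simp at hh)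
  have h1 := congrArg δ e
  rw [Derivation.leibniz, der_aeval_of_const hδ, der_aeval_of_const hδ, hδs] at h1
  simp only [smul_eq_mul, mul_one] at h1
  have hz : z ∈ localRing k s := ⟨f, h, hh, e⟩
  have : δ z = (aeval s (derivative f) - z * aeval s (derivative h)) * (aeval s h)⁻¹ := by
    field_simp
    linear_combination h1
  rw [this]
  exact mul_mem (sub_mem (aeval_mem_localRing s _) (mul_mem hz (aeval_mem_localRing s _)))
    (inv_aeval_mem_localRing hs hh)

theorem exists_logDer_eq (hs : Transcendental k s)
    (hδ : ∀ a, δ (algebraMap k A a) = 0) (hδs : δ s = 1)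
    {z : A} (hz : z ∈ k⟮s⟯) (h0 : z ≠ 0) :
    ∃ n : ℤ, ∃ o ∈ localRing k s, s * (δ z / z) = n + s * o := by
  obtain ⟨n, f, h, hf, hh, e⟩ := exists_eq_zpow_mul hs hz h0
  have hs0 : s ≠ 0 := fun h => hs (h ▸ isAlgebraic_zero)
  have hf0 := aeval_ne_zero_of_transcendental hs (f := f) (by rintro rfl; simp at hf)
  have hh0 := aeval_ne_zero_of_transcendental hs (f := h) (by rintro rfl; simp at hh)
  set w := aeval s f / aeval s h with hw
  have hw0 : w ≠ 0 := div_ne_zero hf0 hh0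
  refine ⟨n, δ w * (aeval s h * (aeval s f)⁻¹), mul_mem (der_mem_localRing hs hδ hδs ?_)
    (mul_mem (aeval_mem_localRing s _) (inv_aeval_mem_localRing hs hf)), ?_⟩
  · rw [hw, div_eq_mul_inv]
    exact mul_mem (aeval_mem_localRing s _) (inv_aeval_mem_localRing hs hh)
  · have h1 : aeval s h * (aeval s f)⁻¹ = w⁻¹ := by rw [hw, inv_div, div_eq_mul_inv]
    have hn := zpow_ne_zero n hs0
    rw [h1, ← mul_div_assoc, e, der_zpow_mul hs hδs]
    field_simp

/-- The derivative of a rational function has no residue at the origin. -/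
theorem residue_der_eq_zero (hs : Transcendental k s)
    (hδ : ∀ a, δ (algebraMap k A a) = 0) (hδs : δ s = 1)
    {z : A} (hz : z ∈ k⟮s⟯) {a : k} {o : A} (ho : o ∈ localRing k s)
    (h : s * δ z = algebraMap k A a + s * o) : a = 0 := by
  rcases eq_or_ne z 0 with rfl | h0
  · exact eq_zero_of_algebraMap_eq_mul hs (neg_mem ho) (by
      simp only [map_zero, mul_zero] at h; linear_combination -h)
  obtain ⟨n, f, q, hf, hq, e⟩ := exists_eq_zpow_mul hs hz h0
  have hs0 : s ≠ 0 := fun h => hs (h ▸ isAlgebraic_zero)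
  have hf0 := aeval_ne_zero_of_transcendental hs (f := f) (by rintro rfl; simp at hf)
  have hq0 := aeval_ne_zero_of_transcendental hs (f := q) (by rintro rfl; simp at hq)
  have hsm : s ∈ localRing k s := by simpa using aeval_mem_localRing s (X : k[X])
  have hw : aeval s f / aeval s q ∈ localRing k s := by
    rw [div_eq_mul_inv]
    exact mul_mem (aeval_mem_localRing s _) (inv_aeval_mem_localRing hs hq)
  rcases le_or_gt 0 n with hn | hn
  · obtain ⟨m, rfl⟩ := Int.eq_ofNat_of_zero_le hn
    rw [zpow_natCast] at e
    have hz' : z ∈ localRing k s := by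
      rw [e]; exact mul_mem (pow_mem hsm m) hw
    exact eq_zero_of_algebraMap_eq_mul hs (sub_mem (der_mem_localRing hs hδ hδs hz') ho) (by
      linear_combination -h)
  · exfalso
    obtain ⟨m, hm⟩ := Int.eq_ofNat_of_zero_le (show 0 ≤ -n - 1 by omega)
    obtain rfl : n = -((m + 1 : ℕ) : ℤ) := by push_cast; omega
    rw [e, der_zpow_mul hs hδs, zpow_neg, zpow_natCast] at h
    set w := aeval s f / aeval s q with hwdef
    have h1 : (-((m + 1 : ℕ) : ℤ) : ℤ) * w + s * δ w = s ^ (m + 1) * (algebraMap k A a + s * o) := by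
      rw [← h]; field_simp
    have h2 : aeval s (C (-((m : k) + 1)) * f) = s * (aeval s q *
        (s ^ m * (algebraMap k A a + s * o) - δ w)) := by
      have : aeval s f = w * aeval s q := by rw [hwdef]; field_simp
      simp only [map_mul, this, map_neg, map_add, map_natCast, map_one]
      push_cast at h1
      linear_combination aeval s q * h1
    have h3 := coeff_zero_eq_zero_of_aeval_eq_mul hs (mul_mem (aeval_mem_localRing s _)
      (sub_mem (mul_mem (pow_mem hsm m) (add_mem ((localRing k s).algebraMap_mem a)
        (mul_mem hsm ho))) (der_mem_localRing hs hδ hδs hw))) h2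
    rw [mul_coeff_zero, coeff_C_zero, mul_eq_zero, neg_eq_zero] at h3
    exact h3.elim (by exact_mod_cast Nat.succ_ne_zero m) hf

theorem exists_int_relation (hs : Transcendental k s)
    (hδ : ∀ a, δ (algebraMap k A a) = 0) (hδs : δ s = 1)
    {ι : Type*} [Fintype ι] {c : ι → k} {u : ι → A} {w : A}
    (hu : ∀ i, u i ∈ k⟮s⟯) (hu0 : ∀ i, u i ≠ 0) (hw : w ∈ k⟮s⟯)
    (h : ∑ i, algebraMap k A (c i) * (δ (u i) / u i) + δ w = 0) (i₀ : ι) {d : ℕ} (hd : d ≠ 0)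
    (hi₀ : u i₀ = s ^ d) : ∃ n : ι → ℤ, n i₀ ≠ 0 ∧ ∑ i, n i • c i = 0 := by
  choose n o ho hn using fun i => exists_logDer_eq hs hδ hδs (hu i) (hu0 i)
  refine ⟨n, ?_, ?_⟩
  · have hs0 : s ≠ 0 := fun h => hs (h ▸ isAlgebraic_zero)
    have h1 := hn i₀
    have h2 : s * (δ (u i₀) / u i₀) = d := by
      have h3 := der_zpow_mul hs hδs d 1
      rw [hi₀, ← mul_div_assoc, div_eq_iff (pow_ne_zero d hs0)]
      simp only [zpow_natCast, mul_one, Int.cast_natCast, Derivation.map_one_eq_zero, mul_zero,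
        add_zero] at h3
      linear_combination h3
    have h4 : ((d : k) - n i₀ : k) = 0 := eq_zero_of_algebraMap_eq_mul hs (ho i₀) (by
      simp only [map_sub, map_natCast, map_intCast]; linear_combination h1 - h2)
    intro h5
    rw [h5] at h4
    simp [hd] at h4
  · refine residue_der_eq_zero hs hδ hδs (neg_mem hw)
      (o := ∑ i, algebraMap k A (c i) * o i)
      (sum_mem fun i _ => mul_mem ((localRing k s).algebraMap_mem _) (ho i)) ?_
    have h1 : s * δ w = - ∑ i, algebraMap k A (c i) * (s * (δ (u i) / u i)) := by
      have : ∑ i, algebraMap k A (c i) * (s * (δ (u i) / u i)) =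
        s * ∑ i, algebraMap k A (c i) * (δ (u i) / u i) := by
        rw [Finset.mul_sum]; exact Finset.sum_congr rfl fun i _ => by ring
      rw [this]; linear_combination s * h
    rw [map_neg, mul_neg, h1, neg_neg, map_sum, Finset.mul_sum, ← Finset.sum_add_distrib]
    refine Finset.sum_congr rfl fun i _ => ?_
    rw [hn]
    simp
    ring

end Residue

section LogDer

variable {A : Type*} [Field A] [CharZero A] (δ : Derivation ℚ A A)

theorem logDer_mul {a b : A} (ha : a ≠ 0) (hb : b ≠ 0) :
    δ (a * b) / (a * b) = δ a / a + δ b / b := by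
  rw [Derivation.leibniz, smul_eq_mul, smul_eq_mul]
  field_simp
  ring

theorem logDer_prod {ι : Type*} (t : Finset ι) {f : ι → A} (hf : ∀ i ∈ t, f i ≠ 0) :
    δ (∏ i ∈ t, f i) / ∏ i ∈ t, f i = ∑ i ∈ t, δ (f i) / f i := by
  classical
  induction t using Finset.induction_on with
  | empty => simp
  | insert a t ha ih =>
    rw [Finset.prod_insert ha, Finset.sum_insert ha, logDer_mul δ (hf a (Finset.mem_insert_self a t))
      (Finset.prod_ne_zero_iff.2 fun i hi => hf i (Finset.mem_insert_of_mem hi)),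
      ih fun i hi => hf i (Finset.mem_insert_of_mem hi)]

theorem logDer_zpow {a : A} (ha : a ≠ 0) (n : ℤ) : δ (a ^ n) / a ^ n = n * (δ a / a) := by
  rw [Derivation.leibniz_zpow, zpow_sub_one₀ ha]
  have := zpow_ne_zero n ha
  simp only [smul_eq_mul, zsmul_eq_mul]
  field_simp

end LogDer

section Norm

/-- The restriction of a derivation to an intermediate field it preserves. -/
def derRestrict {F A : Type*} [Field F] [Field A] [Algebra F A] [CharZero A]
    (K : IntermediateField F A) [CharZero K] (δ : Derivation ℚ A A) (h : ∀ a ∈ K, δ a ∈ K) :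
    Derivation ℚ K K :=
  Derivation.mk' (AddMonoidHom.toRatLinearMap
    { toFun := fun a => ⟨δ a, h a a.2⟩
      map_zero' := by ext; simp
      map_add' := fun a b => by ext; simp }) fun a b => by
    ext
    change δ (a * b) = a * δ b + b * δ a
    simp

theorem derRestrict_apply {F A : Type*} [Field F] [Field A] [Algebra F A] [CharZero A]
    (K : IntermediateField F A) [CharZero K] (δ : Derivation ℚ A A) (h : ∀ a ∈ K, δ a ∈ K)
    (a : K) : δ (algebraMap K A a) = algebraMap K A (derRestrict K δ h a) := rfl

variable {k A : Type*} [Field k] [Field A] [CharZero k] [CharZero A] [Algebra k A]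

theorem der_algHom {d : Derivation ℚ k k} {δ : Derivation ℚ A A}
    (h : ∀ a, δ (algebraMap k A a) = algebraMap k A (d a)) {E : IntermediateField k A}
    (σ : E →ₐ[k] A) (e : E) (he : IsAlgebraic k (e : A)) (hde : δ e ∈ E) :
    δ (σ e) = σ ⟨δ e, hde⟩ := by
  have hval (q : k[X]) : ((aeval e q : E) : A) = aeval (e : A) q :=
    (aeval_algHom_apply E.val e q).symm
  set p := minpoly k (e : A)
  have hp : aeval e p = 0 := Subtype.ext ((hval p).trans (minpoly.aeval k (e : A)))
  have h1 : aeval e (polyDer d 0 p) + aeval e (derivative p) * (⟨δ e, hde⟩ : E) = 0 := by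
    have := der_aeval h (e : A) p
    rw [minpoly.aeval, map_zero] at this
    apply Subtype.ext
    change ((aeval e (polyDer d 0 p) : E) : A) + ((aeval e (derivative p) : E) : A) * δ e = 0
    rw [hval, hval]
    exact this.symm
  have h2 := congrArg σ h1
  rw [map_add, map_mul, map_zero, ← aeval_algHom_apply, ← aeval_algHom_apply] at h2
  have h3 := der_aeval h (σ e) p
  rw [aeval_algHom_apply, hp, map_zero, map_zero] at h3
  have h4 : aeval (σ e) (derivative p) ≠ 0 := by
    rw [aeval_algHom_apply, ne_eq, map_eq_zero σ]
    intro h5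
    apply aeval_derivative_minpoly_ne_zero he
    rw [← hval, h5, ZeroMemClass.coe_zero]
  apply mul_left_cancel₀ h4
  linear_combination h3.symm - h2

theorem exists_int_relation_of_isAlgebraic [IsAlgClosed A] {s : A} (hs : Transcendental k s)
    {δ : Derivation ℚ A A} (hδ : ∀ a, δ (algebraMap k A a) = 0) (hδs : δ s = 1)
    {ι : Type*} [Fintype ι] {c : ι → k} {u : ι → A} {w : A}
    (hu : ∀ i, IsAlgebraic k⟮s⟯ (u i)) (hu0 : ∀ i, u i ≠ 0) (hw : IsAlgebraic k⟮s⟯ w)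
    (h : ∑ i, algebraMap k A (c i) * (δ (u i) / u i) + δ w = 0) (i₀ : ι) (hi₀ : u i₀ = s) :
    ∃ n : ι → ℤ, n i₀ ≠ 0 ∧ ∑ i, n i • c i = 0 := by
  have hst : ∀ a ∈ k⟮s⟯, δ a ∈ k⟮s⟯ := fun a ha => by
    obtain ⟨p, q, rfl⟩ := (mem_adjoin_simple_iff k a).1 ha
    have hm (p : k[X]) : aeval s p ∈ k⟮s⟯ :=
      algebra_adjoin_le_adjoin _ _ (aeval_mem_adjoin_singleton k s)
    rw [Derivation.leibniz_div, der_aeval_of_const hδ, der_aeval_of_const hδ, hδs]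
    simp only [smul_eq_mul, mul_one]
    exact mul_mem (pow_mem (inv_mem (hm _)) 2)
      (sub_mem (mul_mem (hm _) (hm _)) (mul_mem (hm _) (hm _)))
  have hd := derRestrict_apply k⟮s⟯ δ hst
  set d := derRestrict k⟮s⟯ δ hst
  let S : Set A := insert w (Set.range u)
  have hS : ∀ x ∈ S, IsAlgebraic k⟮s⟯ x := by
    rintro x (rfl | ⟨i, rfl⟩)
    exacts [hw, hu i]
  let E := IntermediateField.adjoin k⟮s⟯ S
  have hfin : FiniteDimensional k⟮s⟯ E := by
    have : Finite S := ((Set.finite_range u).insert w).to_subtype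
    exact finiteDimensional_adjoin fun x hx => (hS x hx).isIntegral
  have : Module.Free k⟮s⟯ E := Module.Free.of_divisionRing _ _
  have hwE : w ∈ E := subset_adjoin _ _ (Set.mem_insert _ _)
  have huE (i) : u i ∈ E := subset_adjoin _ _ (Set.mem_insert_of_mem _ ⟨i, rfl⟩)
  have hdE {x : A} (hx : x ∈ E) (hxa : IsAlgebraic k⟮s⟯ x) : δ x ∈ E :=
    adjoin_simple_le_iff.2 hx (der_mem_adjoin hd hxa)
  let U (i : ι) : E := ⟨u i, huE i⟩
  let W : E := ⟨w, hwE⟩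
  have hU0 (i) : U i ≠ 0 := fun hi => hu0 i (congrArg Subtype.val hi)
  have hσ (σ : E →ₐ[k⟮s⟯] A) :
      ∑ i, algebraMap k A (c i) * (δ (σ (U i)) / σ (U i)) + δ (σ W) = 0 := by
    have h1 : ∑ i, algebraMap k⟮s⟯ E (algebraMap k _ (c i)) *
        ((⟨δ (u i), hdE (huE i) (hu i)⟩ : E) / U i) + ⟨δ w, hdE hwE hw⟩ = 0 := by
      apply E.val.injective
      simpa [U] using h
    have h2 := congrArg σ h1
    simp only [map_add, map_sum, map_mul, map_div₀, map_zero, AlgHom.commutes] at h2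
    rw [der_algHom hd σ W hw (hdE hwE hw), ← h2]
    congr 1
    refine Finset.sum_congr rfl fun i _ => ?_
    rw [der_algHom hd σ (U i) (hu i) (hdE (huE i) (hu i))]
    rfl
  refine exists_int_relation hs hδ hδs (c := c)
    (u := fun i => algebraMap k⟮s⟯ A (Algebra.norm k⟮s⟯ (U i)))
    (w := algebraMap k⟮s⟯ A (Algebra.trace k⟮s⟯ E W)) (fun i => Subtype.property _) (fun i => ?_)
    (Subtype.property _) ?_ i₀ (d := Module.finrank k⟮s⟯ E) Module.finrank_pos.ne' ?_
  · simpa [Algebra.norm_eq_zero_iff] using hU0 i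
  · rw [trace_eq_sum_embeddings A]
    simp only [Algebra.norm_eq_prod_embeddings k⟮s⟯ A, map_sum]
    have h1 (i) : δ (∏ σ : E →ₐ[k⟮s⟯] A, σ (U i)) / (∏ σ : E →ₐ[k⟮s⟯] A, σ (U i)) =
        ∑ σ : E →ₐ[k⟮s⟯] A, δ (σ (U i)) / σ (U i) :=
      logDer_prod δ _ fun σ _ => by simpa using hU0 i
    simp only [h1, Finset.mul_sum]
    rw [Finset.sum_comm, ← Finset.sum_add_distrib]
    exact Finset.sum_eq_zero fun σ _ => hσ σ
  · have h1 : U i₀ = algebraMap k⟮s⟯ E (AdjoinSimple.gen k s) := Subtype.ext (by simp [U, hi₀])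
    simp only [h1, Algebra.norm_algebraMap, map_pow, AdjoinSimple.algebraMap_gen]

end Norm

section FirstIntegral

variable {k A : Type*} [Field k] [Field A] [CharZero k] [CharZero A] [Algebra k A]

theorem exists_derivation_comp {δ : Derivation ℚ A A}
    (h : ∀ a : k, ∃ b : k, δ (algebraMap k A a) = algebraMap k A b) :
    ∃ d : Derivation ℚ k k, ∀ a, δ (algebraMap k A a) = algebraMap k A (d a) := by
  choose f hf using h
  refine ⟨Derivation.mk' (AddMonoidHom.toRatLinearMap
    { toFun := f
      map_zero' := (algebraMap k A).injective (by rw [← hf]; simp)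
      map_add' := fun a b => (algebraMap k A).injective (by
        rw [map_add, ← hf, ← hf, ← hf, map_add, map_add]) }) fun a b => ?_, hf⟩
  change f (a * b) = a * f b + b * f a
  apply (algebraMap k A).injective
  rw [map_add, map_mul, map_mul, ← hf, ← hf, ← hf, map_mul, Derivation.leibniz]
  rfl

/-- A first integral algebraic over `k` which is not constant gives one in `k`. -/
theorem exists_first_integral {dX dY : Derivation ℚ k k} {X Y : Derivation ℚ A A}
    (hX : ∀ a, X (algebraMap k A a) = algebraMap k A (dX a))
    (hY : ∀ a, Y (algebraMap k A a) = algebraMap k A (dY a))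
    {y : A} (hy : IsAlgebraic k y) (hXy : X y = 0) (hYy : Y y ≠ 0) :
    ∃ z : k, dX z = 0 ∧ dY z ≠ 0 := by
  set p := minpoly k y
  have h0 : polyDer dX 0 p = 0 := by
    by_contra h
    have h1 := der_aeval hX y p
    rw [minpoly.aeval, map_zero, hXy, mul_zero, add_zero] at h1
    refine (minpoly.degree_le_of_ne_zero k y h h1.symm).not_gt ?_
    rw [degree_eq_natDegree (minpoly.ne_zero hy.isIntegral), degree_lt_iff_coeff_zero]
    intro i hi
    rw [coeff_polyDer_zero]
    rcases hi.eq_or_lt with rfl | hi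
    · rw [coeff_natDegree, (minpoly.monic hy.isIntegral).leadingCoeff, Derivation.map_one_eq_zero]
    · rw [coeff_eq_zero_of_natDegree_lt hi, map_zero]
  by_contra! hc
  have h1 : polyDer dY 0 p = 0 := by
    ext i
    rw [coeff_polyDer_zero, coeff_zero]
    refine hc _ ?_
    rw [← coeff_polyDer_zero, h0, coeff_zero]
  have h2 := der_aeval hY y p
  rw [minpoly.aeval, map_zero, h1, map_zero, zero_add, zero_eq_mul] at h2
  exact h2.elim (aeval_derivative_minpoly_ne_zero hy) hYy

theorem exists_coprime_div {t z : A} (hz : z ∈ k⟮t⟯) :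
    ∃ p q : k[X], IsCoprime p q ∧ q.Monic ∧ z = aeval t p / aeval t q := by
  obtain ⟨f, g, rfl⟩ := (mem_adjoin_simple_iff k z).1 hz
  by_cases hg : aeval t g = 0
  · exact ⟨0, 1, isCoprime_one_right, monic_one, by simp [hg]⟩
  have hg0 : g ≠ 0 := fun h => hg (by simp [h])
  classical
  let : GCDMonoid k[X] := EuclideanDomain.gcdMonoid k[X]
  have hcop := isCoprime_div_gcd_div_gcd (p := f) hg0
  obtain ⟨f', hf⟩ := GCDMonoid.gcd_dvd_left f g
  obtain ⟨g', hg'⟩ := GCDMonoid.gcd_dvd_right f g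
  have hd0 : GCDMonoid.gcd f g ≠ 0 := fun h => hg0 (by rw [hg', h, zero_mul])
  have e1 : f / GCDMonoid.gcd f g = f' :=
    (EuclideanDomain.eq_div_of_mul_eq_right hd0 hf.symm).symm
  have e2 : g / GCDMonoid.gcd f g = g' :=
    (EuclideanDomain.eq_div_of_mul_eq_right hd0 hg'.symm).symm
  rw [e1, e2] at hcop
  generalize GCDMonoid.gcd f g = e at *
  subst hf hg'
  have hl : g'.leadingCoeff ≠ 0 := leadingCoeff_ne_zero.2 (right_ne_zero_of_mul hg0)
  have hu : IsUnit (C g'.leadingCoeff⁻¹) := (isUnit_iff_ne_zero.2 (inv_ne_zero hl)).map C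
  refine ⟨f' * C g'.leadingCoeff⁻¹, g' * C g'.leadingCoeff⁻¹, ?_,
    monic_mul_leadingCoeff_inv (right_ne_zero_of_mul hg0), ?_⟩
  · exact (isCoprime_mul_unit_right hu f' g').2 hcop
  · rw [map_mul] at hg
    have h1 : algebraMap k A g'.leadingCoeff⁻¹ ≠ 0 := by simpa using hl
    simp only [map_mul, aeval_C]
    rw [mul_div_mul_left _ _ (left_ne_zero_of_mul hg), mul_div_mul_right _ _ h1]

theorem exists_polyDer_eq_mul {t z : A} (ht : Transcendental k t) {d : Derivation ℚ k k}
    {X : Derivation ℚ A A} (hX : ∀ a, X (algebraMap k A a) = algebraMap k A (d a)) {v : k[X]}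
    (hv : X t = aeval t v) (hv1 : v.natDegree ≤ 1) (hz : z ∈ k⟮t⟯) (hXz : X z = 0) :
    ∃ (p q : k[X]) (a : k), q.Monic ∧ z = aeval t p / aeval t q ∧
      polyDer d v p = C a * p ∧ polyDer d v q = C a * q := by
  obtain ⟨p, q, hpq, hq, rfl⟩ := exists_coprime_div hz
  have hq0 : aeval t q ≠ 0 := aeval_ne_zero_of_transcendental ht hq.ne_zero
  have h1 : polyDer d v p * q = p * polyDer d v q := by
    apply transcendental_iff_injective.1 ht
    rw [Derivation.leibniz_div] at hXz
    simp only [smul_eq_mul, der_aeval_of_der_eq hX hv] at hXz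
    rw [map_mul, map_mul]
    have := (mul_eq_zero.1 hXz).resolve_left (pow_ne_zero _ (inv_ne_zero hq0))
    linear_combination this
  have h2 : q ∣ polyDer d v q := hpq.symm.dvd_of_dvd_mul_left (h1 ▸ dvd_mul_left _ _)
  obtain ⟨b, hb⟩ := h2
  have hdeg : (polyDer d v q).natDegree ≤ q.natDegree := by
    rw [polyDer_eq]
    refine natDegree_add_le_of_degree_le (natDegree_le_iff_coeff_eq_zero.2 fun i hi => ?_) ?_
    · rw [coeff_polyDer_zero, coeff_eq_zero_of_natDegree_lt hi, map_zero]
    · by_cases h0 : q.natDegree = 0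
      · rw [derivative_of_natDegree_zero h0]; simp
      · refine natDegree_mul_le.trans ?_
        have := natDegree_derivative_lt h0
        omega
  have hb0 : b.natDegree = 0 := by
    by_cases hb0 : b = 0
    · simp [hb0]
    · rw [hb, natDegree_mul hq.ne_zero hb0] at hdeg
      omega
  rw [natDegree_eq_zero] at hb0
  obtain ⟨a, rfl⟩ := hb0
  refine ⟨p, q, a, hq, rfl, ?_, by rw [hb, mul_comm]⟩
  apply mul_right_cancel₀ hq.ne_zero
  rw [h1, hb]; ring

theorem coeff_polyDer (d : Derivation ℚ k k) (v p : k[X]) (i : ℕ) :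
    (polyDer d v p).coeff i = d (p.coeff i) + (v * derivative p).coeff i := by
  rw [polyDer_eq, coeff_add, coeff_polyDer_zero]

end FirstIntegral

section Relations

/-- The value of the form `∑ i, c i * du i / u i + dv` on the derivation `δ`. -/
def logForm (δ : Derivation ℚ U U) {m : ℕ} (c : Fin m → ℂ) (u : Fin m → U) (v : U) : U :=
  ∑ i, algebraMap ℂ U (c i) * (δ (u i) / u i) + δ v

/-- There is a logarithmic form with entries in `S` annihilated by `X` and not by all `D j`. -/
def HasRel (X : Derivation ℚ U U) {N : ℕ} (D : Fin N → Derivation ℚ U U) (S : Set U) : Prop :=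
  ∃ (m : ℕ) (c : Fin m → ℂ) (u : Fin m → U) (v : U), (∀ i, u i ∈ S ∧ u i ≠ 0) ∧ v ∈ S ∧
    logForm X c u v = 0 ∧ ∃ j, logForm (D j) c u v ≠ 0

variable {X : Derivation ℚ U U} {N : ℕ} {D : Fin N → Derivation ℚ U U}

theorem HasRel.of_der {S : Set U} {v : U} (hv : v ∈ S) (hX : X v = 0) {j : Fin N}
    (hj : D j v ≠ 0) : HasRel X D S :=
  ⟨0, Fin.elim0, Fin.elim0, v, fun i => i.elim0, hv, by simp [logForm, hX], j,
    by simpa [logForm] using hj⟩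

theorem HasRel.of_logDer {S : Set U} {u v : U} (hu : u ∈ S) (hu0 : u ≠ 0) (hv : v ∈ S)
    (hX : X u / u + X v = 0) {j : Fin N} (hj : D j u / u + D j v ≠ 0) : HasRel X D S :=
  ⟨1, fun _ => 1, fun _ => u, v, fun _ => ⟨hu, hu0⟩, hv, by simpa [logForm] using hX, j,
    by simpa [logForm] using hj⟩

/-- The elements of `F` algebraic over `k`. -/
def relAlg (k F : IntermediateField ℂ U) : IntermediateField ℂ U :=
  F ⊓ (algebraicClosure k U).restrictScalars ℂ

variable {k F : IntermediateField ℂ U}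

theorem mem_relAlg {a : U} : a ∈ relAlg k F ↔ a ∈ F ∧ IsAlgebraic k a := by
  rw [relAlg, IntermediateField.mem_inf, IntermediateField.mem_restrictScalars,
    mem_algebraicClosure_iff]

theorem coe_mem_relAlg (h : k ≤ F) (a : k) : (a : U) ∈ relAlg k F :=
  mem_relAlg.2 ⟨h a.2, isAlgebraic_algebraMap a⟩

theorem hasRel_of_log {t R : U} (hkF : k ≤ F)
    (hconst : ∀ a ∈ F, (∀ j, D j a = 0) → a ∈ k) (htF : t ∈ F) (ht : Transcendental k t)
    (hR : R ∈ k) (hR0 : R ≠ 0) (hDt : ∀ j, D j t = D j R / R) (hXt : X t = X R / R)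
    {d : Derivation ℚ k k} (hX : ∀ a, X (algebraMap k U a) = algebraMap k U (d a))
    {z : U} (hz : z ∈ k⟮t⟯) (hXz : X z = 0) {j : Fin N} (hj : D j z ≠ 0) :
    HasRel X D (relAlg k F) := by
  set ρ : k := ⟨R, hR⟩
  have hXR : X R = d ρ := hX ρ
  have hv : X t = aeval t (C (d ρ / ρ)) := by
    rw [hXt, hXR, aeval_C]; simp [ρ, IntermediateField.algebraMap_apply]
  obtain ⟨p, q, a, hq, rfl, hp', hq'⟩ := exists_polyDer_eq_mul ht hX hv (by simp) hz hXz
  have ha : a = 0 := by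
    have := congrArg (coeff · q.natDegree) hq'
    simp only [coeff_polyDer, coeff_C_mul, hq.coeff_natDegree, coeff_derivative,
      coeff_eq_zero_of_natDegree_lt (Nat.lt_succ_self _)] at this
    simpa using this.symm
  subst ha
  obtain ⟨f, hf, hfj⟩ : ∃ f : k[X], polyDer d (C (d ρ / ρ)) f = 0 ∧ D j (aeval t f) ≠ 0 := by
    by_contra! hc
    apply hj
    rw [Derivation.leibniz_div, hc p (by rw [hp']; simp), hc q (by rw [hq']; simp)]
    simp
  have hcoeff (i : ℕ) : d (f.coeff i) + d ρ / ρ * (f.coeff (i + 1) * (i + 1)) = 0 := by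
    have := congrArg (coeff · i) hf
    simpa only [coeff_polyDer, coeff_C_mul, coeff_derivative, coeff_zero] using this
  have hlead : d (f.coeff f.natDegree) = 0 := by
    simpa [coeff_eq_zero_of_natDegree_lt (Nat.lt_succ_self f.natDegree)] using hcoeff f.natDegree
  by_cases hDl : ∃ i, D i (f.coeff f.natDegree : U) ≠ 0
  · obtain ⟨i, hi⟩ := hDl
    exact .of_der (coe_mem_relAlg hkF _) ((hX _).trans (by rw [hlead, map_zero])) hi
  push Not at hDl
  by_cases hN : f.natDegree = 0
  · obtain ⟨b, rfl⟩ := natDegree_eq_zero.1 hN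
    simp at hDl
    simp [hDl, IntermediateField.algebraMap_apply] at hfj
  obtain ⟨M, hM⟩ := Nat.exists_eq_succ_of_ne_zero hN
  have hf0 : f.coeff (M + 1) ≠ 0 := by
    rw [← Nat.succ_eq_add_one, ← hM, coeff_natDegree, leadingCoeff_ne_zero]
    rintro rfl
    simp at hN
  rw [hM] at hlead hDl
  have hM1 : ((M : k) + 1) ≠ 0 := by exact_mod_cast M.succ_ne_zero
  set y : k := f.coeff M / (f.coeff (M + 1) * (M + 1))
  have hy : d y = - (d ρ / ρ) := by
    have h1 : d (f.coeff (M + 1) * ((M : k) + 1)) = 0 := by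
      rw [Derivation.leibniz, hlead]
      simp
    have h2 := hcoeff M
    rw [Derivation.leibniz_div, h1]
    rw [eq_neg_of_add_eq_zero_left h2]
    simp only [smul_eq_mul]
    field_simp
    simp
  have hXy : X (y : U) = - (X R / R) := by
    refine (hX y).trans ?_
    rw [hy, hXR]
    simp [ρ, IntermediateField.algebraMap_apply]
  obtain ⟨i, hi⟩ : ∃ i, D i R / R + D i (y : U) ≠ 0 := by
    by_contra! hc
    have h1 : t + y ∈ k := hconst _ (add_mem htF (hkF y.2)) fun i => by
      rw [map_add, hDt, hc]
    refine ht ?_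
    have h2 : t ∈ k := by simpa using sub_mem h1 y.2
    exact isAlgebraic_algebraMap (⟨t, h2⟩ : k)
  exact .of_logDer (coe_mem_relAlg hkF ρ) hR0 (coe_mem_relAlg hkF y)
    (by rw [hXy]; exact add_neg_cancel _) hi

theorem hasRel_of_exp {t R : U} (hkF : k ≤ F)
    (hconst : ∀ a ∈ F, (∀ j, D j a = 0) → a ∈ k) (htF : t ∈ F) (ht : Transcendental k t)
    (hR : R ∈ k) (hDt : ∀ j, D j t = t * D j R) (hXt : X t = t * X R)
    {d : Derivation ℚ k k} (hX : ∀ a, X (algebraMap k U a) = algebraMap k U (d a))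
    {z : U} (hz : z ∈ k⟮t⟯) (hXz : X z = 0) {j : Fin N} (hj : D j z ≠ 0) :
    HasRel X D (relAlg k F) := by
  set ρ : k := ⟨R, hR⟩
  have hXR : X R = d ρ := hX ρ
  have ht0 : t ≠ 0 := fun h => ht (h ▸ isAlgebraic_zero)
  have hv : X t = aeval t (C (d ρ) * Polynomial.X) := by
    rw [hXt, hXR, map_mul, aeval_C, aeval_X, mul_comm]; rfl
  obtain ⟨p, q, a, hq, rfl, hp', hq'⟩ := exists_polyDer_eq_mul ht hX hv
    ((natDegree_C_mul_le _ _).trans natDegree_X_le) hz hXz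
  have hcoeff {f : k[X]} (hf : polyDer d (C (d ρ) * Polynomial.X) f = C a * f) (i : ℕ) :
      d (f.coeff i) = (a - d ρ * i) * f.coeff i := by
    have := congrArg (coeff · i) hf
    simp only [coeff_polyDer, coeff_C_mul, mul_assoc] at this
    have h2 : (Polynomial.X * derivative f).coeff i = i * f.coeff i := by
      cases i with
      | zero => simp
      | succ i => rw [coeff_X_mul, coeff_derivative]; push_cast; ring
    rw [h2] at this
    linear_combination this
  have ha : a = d ρ * q.natDegree := by
    have := hcoeff hq' q.natDegree
    rw [hq.coeff_natDegree, Derivation.map_one_eq_zero] at this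
    linear_combination -this
  by_cases hc : ∃ (f : k[X]) (i : ℕ), polyDer d (C (d ρ) * Polynomial.X) f = C a * f ∧
      f.coeff i ≠ 0 ∧ i ≠ q.natDegree
  · obtain ⟨f, i, hf, hfi, hi⟩ := hc
    set b := f.coeff i
    have hb : (b : U) ≠ 0 := by simpa using hfi
    set n : ℤ := i - q.natDegree
    have hn : n ≠ 0 := by omega
    have hdb : X (b : U) = - (n * X R) * b := by
      refine (hX b).trans ?_
      rw [hcoeff hf i, ha, hXR]
      simp [n, IntermediateField.algebraMap_apply]
      ring
    have hnR (Y : Derivation ℚ U U) : Y (n * R) = n * Y R := by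
      rw [Derivation.leibniz]; simp
    obtain ⟨l, hl⟩ : ∃ l, D l (b : U) / b + D l (n * R) ≠ 0 := by
      by_contra! hc
      have h1 : (b : U) * t ^ n ∈ k := by
        refine hconst _ (mul_mem (hkF b.2) (zpow_mem htF n)) fun l => ?_
        have h1 := logDer_mul (D l) hb (zpow_ne_zero n ht0)
        rw [logDer_zpow (D l) ht0, hDt, mul_div_cancel_left₀ _ ht0, ← hnR, hc] at h1
        exact (div_eq_zero_iff.1 h1).resolve_right (mul_ne_zero hb (zpow_ne_zero n ht0))
      have h2 : t ^ n ∈ k := by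
        have := mul_mem (inv_mem b.2) h1
        rwa [inv_mul_cancel_left₀ hb] at this
      have h3 : t ^ n.natAbs ∈ k := by
        rcases Int.natAbs_eq n with h | h
        · rw [h] at h2; exact_mod_cast h2
        · rw [h, zpow_neg] at h2; simpa only [inv_inv, zpow_natCast] using inv_mem h2
      exact ht (.of_pow (Int.natAbs_pos.2 hn) (isAlgebraic_algebraMap (⟨_, h3⟩ : k)))
    refine .of_logDer (coe_mem_relAlg hkF b) hb
      (v := n * R) (coe_mem_relAlg hkF ((n : k) * ρ)) ?_ hl
    rw [hnR, hdb, mul_div_cancel_right₀ _ hb, neg_add_cancel]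
  · push Not at hc
    have hmon {f : k[X]} (hf : polyDer d (C (d ρ) * Polynomial.X) f = C a * f) :
        f = C (f.coeff q.natDegree) * Polynomial.X ^ q.natDegree := by
      ext i
      rw [coeff_C_mul_X_pow]
      split_ifs with h
      · rw [h]
      · by_contra h0
        exact h (hc f i hf (by simpa using h0))
    have h1 : aeval t p / aeval t q = (p.coeff q.natDegree : U) := by
      rw [hmon hp', hmon hq', hq.coeff_natDegree]
      simp [ht0, IntermediateField.algebraMap_apply]
    rw [h1] at hXz hj
    exact .of_der (coe_mem_relAlg hkF _) hXz hj

end Relations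

section Independence

theorem exists_derivation_extension {A B : Type*} [Field A] [Field B] [CharZero A] [CharZero B]
    [Algebra A B] [Algebra.IsAlgebraic A B] (δ : Derivation ℚ A A) :
    ∃ ε : Derivation ℚ B B, ∀ a, ε (algebraMap A B a) = algebraMap A B (δ a) := by
  have : Algebra.FormallyEtale A B := .of_isSeparable A B
  let d : Derivation ℚ A B := (Algebra.linearMap A B).compDer δ
  let e := KaehlerDifferential.tensorKaehlerEquivOfFormallyEtale ℚ A B
  let f : TensorProduct A B (Ω[A⁄ℚ]) →ₗ[B] B :=
    LinearMap.liftBaseChange B d.liftKaehlerDifferential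
  refine ⟨(f ∘ₗ e.symm.toLinearMap).compDer (KaehlerDifferential.D ℚ B), fun a => ?_⟩
  change f (e.symm (KaehlerDifferential.D ℚ B (algebraMap A B a))) = _
  rw [KaehlerDifferential.tensorKaehlerEquivOfFormallyEtale_symm_D_algebraMap]
  simp [f, d]

variable {k A : Type*} [Field k] [Field A] [Algebra k A]

theorem isAlgebraic_adjoin_map {B : Type*} [Field B] [Algebra k B] (φ : A →ₐ[k] B) {s x : A}
    (hx : IsAlgebraic k⟮s⟯ x) : IsAlgebraic k⟮φ s⟯ (φ x) := by
  have h : (k⟮s⟯).map φ ≤ k⟮φ s⟯ := by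
    rw [IntermediateField.adjoin_map, Set.image_singleton]
  let f : k⟮s⟯ →+* k⟮φ s⟯ := (φ.toRingHom.comp k⟮s⟯.val.toRingHom).codRestrict k⟮φ s⟯
    fun a => h ⟨a, a.2, rfl⟩
  exact hx.ringHom_of_comp_eq f φ f.injective rfl

variable [CharZero k] [CharZero A]

theorem isAlgebraic_trans_adjoin {s t x : A} (ht : IsAlgebraic k⟮s⟯ t)
    (hx : IsAlgebraic k⟮t⟯ x) : IsAlgebraic k⟮s⟯ x := by
  by_contra h
  obtain ⟨δ, hδ, hδx⟩ := exists_derivation_eq_one h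
  have : δ x = (0 : Derivation ℚ A A) x := der_eq_of_isAlgebraic_adjoin (k := k) (S := {t})
    (fun a => hδ (algebraMap k k⟮s⟯ a)) (by simpa using der_eq_zero_of_isAlgebraic hδ ht) hx
  simp [hδx] at this

/-- In a vanishing logarithmic form with `ℤ`-independent coefficients over a field of algebraic
functions in one variable, all arguments of the logarithmic terms are constant. -/
theorem isAlgebraic_of_linearIndependent {t : A} {δ : Derivation ℚ A A}
    (hδ : ∀ a, δ (algebraMap k A a) = 0) (hδt : δ t ≠ 0)
    {ι : Type*} [Fintype ι] {c : ι → k} (hc : LinearIndependent ℤ c) {u : ι → A} {w : A}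
    (hu : ∀ i, IsAlgebraic k⟮t⟯ (u i)) (hu0 : ∀ i, u i ≠ 0) (hw : IsAlgebraic k⟮t⟯ w)
    (h : ∑ i, algebraMap k A (c i) * (δ (u i) / u i) + δ w = 0) (i : ι) :
    IsAlgebraic k (u i) := by
  by_contra hs
  obtain ⟨ε, hε, hεs⟩ := exists_derivation_eq_one hs
  have hsw : IsAlgebraic k⟮u i⟯ t := isAlgebraic_adjoin_swap (hu i) hs
  have halg {x : A} (hx : IsAlgebraic k⟮t⟯ x) : IsAlgebraic k⟮u i⟯ x := isAlgebraic_trans_adjoin hsw hx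
  have hεδ {x : A} (hx : IsAlgebraic k⟮t⟯ x) : ε x = ε t / δ t * δ x :=
    der_eq_of_isAlgebraic_adjoin (k := k) (S := {t}) (ε := (ε t / δ t) • δ)
      (fun a => by simp [hε, hδ]) (by simp [hδt]) hx
  let φ : A →ₐ[k] AlgebraicClosure A := IsScalarTower.toAlgHom k A (AlgebraicClosure A)
  have : CharZero (AlgebraicClosure A) := charZero_of_injective_algebraMap (algebraMap A _).injective
  obtain ⟨η, hη⟩ := exists_derivation_extension (B := AlgebraicClosure A) ε
  obtain ⟨n, hn, hn0⟩ := exists_int_relation_of_isAlgebraic (k := k) (s := φ (u i)) (δ := η)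
    (c := c) (u := fun j => φ (u j)) (w := φ w)
    (fun h => hs ((isAlgebraic_algHom_iff φ φ.injective).1 h))
    (fun a => by
      rw [IsScalarTower.algebraMap_apply k A, hη, hε, map_zero])
    (by rw [← map_one φ, ← hεs]; exact hη _)
    (fun j => isAlgebraic_adjoin_map φ (halg (hu j))) (fun j => by simpa using hu0 j)
    (isAlgebraic_adjoin_map φ (halg hw))
    (by
      have hφ (x : A) : η (φ x) = φ (ε x) := hη x
      rw [← map_zero φ, ← mul_zero (ε t / δ t), ← h, mul_add, ← hεδ hw, Finset.mul_sum, map_add,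
        map_sum, hφ]
      congr 1
      refine Finset.sum_congr rfl fun j _ => ?_
      rw [hφ, hεδ (hu j), ← AlgHom.commutes φ, ← map_div₀, ← map_mul]
      congr 1
      ring) i rfl
  exact hn (Fintype.linearIndependent_iff.1 hc n hn0 i)

end Independence

section Reduction

theorem exists_linearIndependent_logForm {m : ℕ} (c : Fin m → ℂ) (u : Fin m → U)
    (S : IntermediateField ℂ U) (hu : ∀ i, u i ∈ S ∧ u i ≠ 0) :
    ∃ (r : ℕ) (c' : Fin r → ℂ) (u' : Fin r → U), LinearIndependent ℤ c' ∧
      (∀ i, u' i ∈ S ∧ u' i ≠ 0) ∧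
      ∀ (δ : Derivation ℚ U U) (v : U), logForm δ c' u' v = logForm δ c u v := by
  let M := Submodule.span ℤ (Set.range c)
  have : Module.Finite ℤ M := Module.Finite.span_of_finite ℤ (Set.finite_range c)
  let b := Module.finBasis ℤ M
  let n (i : Fin m) (j : Fin (Module.finrank ℤ M)) : ℤ :=
    b.repr ⟨c i, Submodule.subset_span ⟨i, rfl⟩⟩ j
  have hn (i : Fin m) : c i = ∑ j, n i j * (b j : ℂ) := by
    have := congrArg Subtype.val (b.sum_repr ⟨c i, Submodule.subset_span ⟨i, rfl⟩⟩)
    simpa only [n, Submodule.coe_sum, SetLike.val_smul, zsmul_eq_mul] using this.symm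
  refine ⟨_, fun j => b j, fun j => ∏ i, u i ^ n i j, ?_, fun j => ⟨?_, ?_⟩, fun δ v => ?_⟩
  · exact b.linearIndependent.map' M.subtype (Submodule.ker_subtype _)
  · exact prod_mem fun i _ => zpow_mem (hu i).1 _
  · exact Finset.prod_ne_zero_iff.2 fun i _ => zpow_ne_zero _ (hu i).2
  · simp only [logForm]
    congr 1
    simp only [hn, map_sum, map_mul, map_intCast, Finset.sum_mul,
      logDer_prod δ Finset.univ fun i _ => zpow_ne_zero (n i _) (hu i).2, Finset.mul_sum]
    rw [Finset.sum_comm]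
    refine Finset.sum_congr rfl fun i _ => Finset.sum_congr rfl fun j _ => ?_
    rw [logDer_zpow δ (hu i).2]
    ring

end Reduction

section Step

theorem der_mem_adjoin_of_mem {k A : Type*} [Field k] [Field A] [CharZero A] [Algebra k A]
    {δ : Derivation ℚ A A} {S : Set A}
    (hk : ∀ a : k, δ (algebraMap k A a) ∈ IntermediateField.adjoin k S)
    (hS : ∀ s ∈ S, δ s ∈ IntermediateField.adjoin k S) {a : A}
    (ha : a ∈ IntermediateField.adjoin k S) : δ a ∈ IntermediateField.adjoin k S := by
  induction ha using IntermediateField.adjoin_induction with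
  | mem x hx => exact hS x hx
  | algebraMap a => exact hk a
  | add x y _ _ hx hy => rw [map_add]; exact add_mem hx hy
  | mul x y hxm hym hx hy =>
    rw [Derivation.leibniz]
    exact add_mem (mul_mem hxm hy) (mul_mem hym hx)
  | inv x hxm hx =>
    rw [Derivation.leibniz_inv]
    exact mul_mem (neg_mem (pow_mem (inv_mem hxm) 2)) hx

variable {X : Derivation ℚ U U} {N : ℕ} {D : Fin N → Derivation ℚ U U} {k F : IntermediateField ℂ U}

theorem logForm_mem {M : IntermediateField ℂ U} {δ : Derivation ℚ U U} (hδ : ∀ a ∈ M, δ a ∈ M)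
    {m : ℕ} {c : Fin m → ℂ} {u : Fin m → U} {v : U} (hu : ∀ i, u i ∈ M) (hv : v ∈ M) :
    logForm δ c u v ∈ M :=
  add_mem (sum_mem fun i _ => mul_mem (M.algebraMap_mem _) (div_mem (hδ _ (hu i)) (hu i)))
    (hδ _ hv)

theorem der_logForm_comm {δ : Derivation ℚ U U} {M : Set U} (hXC : ∀ z, X (algebraMap ℂ U z) = 0)
    (hδC : ∀ z, δ (algebraMap ℂ U z) = 0) (hcomm : ∀ a ∈ M, X (δ a) = δ (X a))
    {m : ℕ} {c : Fin m → ℂ} {u : Fin m → U} {v : U} (hu : ∀ i, u i ∈ M ∧ u i ≠ 0) (hv : v ∈ M) :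
    X (logForm δ c u v) = δ (logForm X c u v) := by
  simp only [logForm, map_add, map_sum, hcomm v hv]
  congr 1
  refine Finset.sum_congr rfl fun i _ => ?_
  rw [Derivation.leibniz, Derivation.leibniz, Derivation.leibniz_div, Derivation.leibniz_div, hXC,
    hδC, hcomm _ (hu i).1]
  simp only [smul_eq_mul]
  ring

/-- Applying to a relation a derivation trivial on `k` and commuting with `X` on `t` produces
a first integral. -/
theorem logForm_first_integral {t : U} (hXC : ∀ z, X (algebraMap ℂ U z) = 0)
    (hXk : ∀ a ∈ k, X a ∈ k) {δ : Derivation ℚ U U}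
    (hkF : k ≤ F) (htF : t ∈ F)
    (hδ : ∀ a : k, δ (algebraMap k U a) = 0) (hδt : δ t ∈ k⟮t⟯) (hcomm : X (δ t) = δ (X t))
    {m : ℕ} {c : Fin m → ℂ} {u : Fin m → U} {v : U}
    (hu : ∀ i, (u i ∈ F ∧ IsAlgebraic k⟮t⟯ (u i)) ∧ u i ≠ 0) (hv : v ∈ F ∧ IsAlgebraic k⟮t⟯ v)
    (h : logForm X c u v = 0) :
    logForm δ c u v ∈ F ∧ IsAlgebraic k⟮t⟯ (logForm δ c u v) ∧ X (logForm δ c u v) = 0 := by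
  let M := relAlg (k⟮t⟯.restrictScalars ℂ) F
  have hM {a : U} : a ∈ M ↔ a ∈ F ∧ IsAlgebraic k⟮t⟯ a := mem_relAlg
  have hδC (z : ℂ) : δ (algebraMap ℂ U z) = 0 := hδ (algebraMap ℂ k z)
  obtain ⟨d, hd⟩ := exists_derivation_comp (k := k⟮t⟯) (δ := δ) fun a =>
    ⟨⟨δ a, der_mem_adjoin_of_mem (fun b => by rw [hδ]; exact zero_mem _) (by simpa using hδt) a.2⟩,
      rfl⟩
  have hktF : k⟮t⟯.restrictScalars ℂ ≤ F := by
    rw [IntermediateField.restrictScalars_adjoin, IntermediateField.adjoin_le_iff]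
    exact Set.union_subset hkF (Set.singleton_subset_iff.2 htF)
  have hδM (a : U) (ha : a ∈ M) : δ a ∈ M := by
    rw [hM] at ha ⊢
    have h1 := der_mem_adjoin hd ha.2
    constructor
    · have h2 : (k⟮t⟯⟮a⟯.restrictScalars k).restrictScalars ℂ ≤ F := by
        intro b hb
        have hb' : b ∈ (k⟮t⟯.restrictScalars ℂ)⟮a⟯.restrictScalars ℂ := hb
        rw [IntermediateField.restrictScalars_adjoin] at hb'
        exact (IntermediateField.adjoin_le_iff.2
          (Set.union_subset hktF (Set.singleton_subset_iff.2 ha.1))) hb'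
      exact h2 h1
    · have := isAlgebraic_adjoin_simple ha.2.isIntegral
      exact (isAlgebraic_algebraMap_iff (A := U) (FaithfulSMul.algebraMap_injective k⟮t⟯⟮a⟯ U)).2
        (this.isAlgebraic ⟨δ a, h1⟩)
  have hX : ∀ a ∈ M, X (δ a) = δ (X a) := fun a ha => by
    have h0 (b : k) : X b ∈ k := hXk b b.2
    have := der_eq_of_isAlgebraic_adjoin (k := k) (S := {t}) (δ := ⁅X, δ⁆) (ε := 0)
      (fun b => by
        rw [Derivation.commutator_apply, hδ, map_zero, zero_sub]
        simpa using hδ ⟨X b, h0 b⟩)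
      (by simp [Derivation.commutator_apply, hcomm]) (hM.1 ha).2
    rw [Derivation.commutator_apply] at this
    simpa [sub_eq_zero] using this
  have hg := hM.1 (logForm_mem (c := c) hδM (fun i => hM.2 (hu i).1) (hM.2 hv))
  refine ⟨hg.1, hg.2, ?_⟩
  rw [der_logForm_comm (M := M) hXC hδC hX (fun i => ⟨hM.2 (hu i).1, (hu i).2⟩) (hM.2 hv), h,
    map_zero]

theorem linearIndependent_algebraMap {ι : Type*} {c : ι → ℂ} (hc : LinearIndependent ℤ c) :
    LinearIndependent ℤ fun i => algebraMap ℂ k (c i) :=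
  hc.map' (algebraMap ℂ k).toAddMonoidHom.toIntLinearMap
    (LinearMap.ker_eq_bot.2 (algebraMap ℂ k).injective)

theorem logForm_isAlgebraic {t : U} {δ : Derivation ℚ U U}
    (hδ : ∀ a : k, δ (algebraMap k U a) = 0) (hδt : δ t ≠ 0)
    {m : ℕ} {c : Fin m → ℂ} (hc : LinearIndependent ℤ c) {u : Fin m → U} {v : U}
    (hu : ∀ i, IsAlgebraic k⟮t⟯ (u i)) (hu0 : ∀ i, u i ≠ 0) (hv : IsAlgebraic k⟮t⟯ v)
    (h : logForm δ c u v = 0) : (∀ i, IsAlgebraic k (u i)) ∧ IsAlgebraic k v := by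
  have h1 := isAlgebraic_of_linearIndependent hδ hδt (linearIndependent_algebraMap hc) hu hu0 hv h
  refine ⟨h1, isAlgebraic_of_der_eq_zero hδ hδt hv ?_⟩
  simpa [logForm, der_eq_zero_of_isAlgebraic hδ (h1 _)] using h

end Step

section Step

variable {X : Derivation ℚ U U} {N : ℕ} {D : Fin N → Derivation ℚ U U} {k F : IntermediateField ℂ U}

theorem exists_first_integral_mem {Y : Derivation ℚ U U} {t g : U} (hXk : ∀ a ∈ k, X a ∈ k)
    (hYk : ∀ a ∈ k, Y a ∈ k) (hXt : X t ∈ k⟮t⟯) (hYt : Y t ∈ k⟮t⟯)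
    (hg : IsAlgebraic k⟮t⟯ g) (hXg : X g = 0) (hYg : Y g ≠ 0) :
    ∃ z ∈ k⟮t⟯, X z = 0 ∧ Y z ≠ 0 := by
  have h {Z : Derivation ℚ U U} (hZk : ∀ a ∈ k, Z a ∈ k) (hZt : Z t ∈ k⟮t⟯) :
      ∃ d : Derivation ℚ k⟮t⟯ k⟮t⟯, ∀ a, Z (algebraMap k⟮t⟯ U a) = algebraMap k⟮t⟯ U (d a) :=
    exists_derivation_comp fun a => ⟨⟨Z a, der_mem_adjoin_of_mem
      (k := k) (fun b => k⟮t⟯.algebraMap_mem ⟨Z b, hZk b b.2⟩) (by simpa using hZt) a.2⟩, rfl⟩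
  obtain ⟨dX, hdX⟩ := h hXk hXt
  obtain ⟨dY, hdY⟩ := h hYk hYt
  obtain ⟨z, hz, hz'⟩ := exists_first_integral hdX hdY hg hXg hYg
  refine ⟨z, z.2, (hdX z).trans (by rw [hz, map_zero]), fun h0 => hz' ?_⟩
  rw [← map_eq_zero (algebraMap k⟮t⟯ U), ← hdY]
  exact h0

/-- A relation algebraic over `k(t)` with `t` a logarithm gives one algebraic over `k`. -/
theorem HasRel.of_adjoin_log {t R : U} (hkF : k ≤ F)
    (hconst : ∀ a ∈ F, (∀ j, D j a = 0) → ∃ z : ℂ, algebraMap ℂ U z = a)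
    (hDC : ∀ j z, D j (algebraMap ℂ U z) = 0) (hXC : ∀ z, X (algebraMap ℂ U z) = 0)
    (hDk : ∀ j, ∀ a ∈ k, D j a ∈ k) (hXk : ∀ a ∈ k, X a ∈ k)
    (htF : t ∈ F) (ht : Transcendental k t) (hR : R ∈ k) (hR0 : R ≠ 0)
    (hDt : ∀ j, D j t = D j R / R) (hXt : X t = X R / R)
    (h : HasRel X D {a | a ∈ F ∧ IsAlgebraic k⟮t⟯ a}) : HasRel X D (relAlg k F) := by
  obtain ⟨m, c, u, v, hu, hv, hX0, j₀, hj₀⟩ := h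
  obtain ⟨δ, hδ, hδt⟩ := exists_derivation_eq_one ht
  have hk (a : U) (ha : a ∈ k) : a ∈ k⟮t⟯ := k⟮t⟯.algebraMap_mem ⟨a, ha⟩
  have hXtk : X t ∈ k := hXt ▸ div_mem (hXk R hR) hR
  obtain ⟨hgF, hga, hgX⟩ := logForm_first_integral hXC hXk hkF htF hδ
    (by rw [hδt]; exact one_mem _)
    (by rw [hδt, Derivation.map_one_eq_zero]; exact (hδ ⟨X t, hXtk⟩).symm) hu hv hX0
  by_cases hgD : ∃ j, D j (logForm δ c u v) ≠ 0
  · obtain ⟨j, hj⟩ := hgD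
    obtain ⟨z, hz, hz0, hzj⟩ := exists_first_integral_mem hXk (hDk j) (hk _ hXtk)
      (hk _ (hDt j ▸ div_mem (hDk j R hR) hR)) hga hgX hj
    obtain ⟨d, hd⟩ := exists_derivation_comp (k := k) (δ := X) fun a => ⟨⟨X a, hXk a a.2⟩, rfl⟩
    refine hasRel_of_log hkF (fun a ha h => ?_) htF ht hR hR0 hDt hXt hd hz hz0 hzj
    obtain ⟨γ, rfl⟩ := hconst a ha h
    exact k.algebraMap_mem γ
  push Not at hgD
  obtain ⟨γ, hγ⟩ := hconst _ hgF hgD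
  obtain ⟨r, c', u', hc', hu', hlog⟩ := exists_linearIndependent_logForm c u
    (relAlg (k⟮t⟯.restrictScalars ℂ) F) fun i => ⟨mem_relAlg.2 (hu i).1, (hu i).2⟩
  have hu'' (i) : u' i ∈ F ∧ IsAlgebraic k⟮t⟯ (u' i) := mem_relAlg.1 (hu' i).1
  have hlin {Y : Derivation ℚ U U} (hY : Y (algebraMap ℂ U γ) = 0) :
      logForm Y c' u' (v - algebraMap ℂ U γ * t) = logForm Y c u v - algebraMap ℂ U γ * Y t := by
    rw [← hlog]
    simp [logForm, hY, add_sub_assoc]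
  have hta : IsAlgebraic k⟮t⟯ t :=
    isAlgebraic_algebraMap (⟨t, IntermediateField.mem_adjoin_simple_self k t⟩ : k⟮t⟯)
  have hγa : IsAlgebraic k⟮t⟯ (algebraMap ℂ U γ) :=
    isAlgebraic_algebraMap (algebraMap k k⟮t⟯ (algebraMap ℂ k γ))
  obtain ⟨hu'a, hwa⟩ := logForm_isAlgebraic hδ (by simp [hδt]) hc' (fun i => (hu'' i).2)
    (fun i => (hu' i).2) (hv.2.sub (hγa.mul hta))
    (by rw [hlin (hδ (algebraMap ℂ k γ)), ← hγ, hδt, mul_one, sub_self])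
  have key {Y : Derivation ℚ U U} (hY : Y (algebraMap ℂ U γ) = 0) (hYt : Y t = Y R / R) :
      logForm Y (Fin.cons γ c' : Fin (r + 1) → ℂ) (Fin.cons R u' : Fin (r + 1) → U)
        (v - algebraMap ℂ U γ * t) = logForm Y c u v := by
    have := hlin hY
    rw [logForm] at this ⊢
    rw [Fin.sum_univ_succ]
    simp only [Fin.cons_zero, Fin.cons_succ]
    rw [add_assoc, this, hYt]
    ring
  refine ⟨r + 1, Fin.cons γ c', Fin.cons R u', v - algebraMap ℂ U γ * t, fun i => ?_, ?_, ?_, j₀, ?_⟩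
  · refine Fin.cases ?_ (fun i => ?_) i
    · exact ⟨coe_mem_relAlg hkF ⟨R, hR⟩, hR0⟩
    · exact ⟨mem_relAlg.2 ⟨(hu'' i).1, hu'a i⟩, (hu' i).2⟩
  · exact mem_relAlg.2 ⟨sub_mem hv.1 (mul_mem (F.algebraMap_mem γ) htF), hwa⟩
  · rw [key (hXC γ) hXt, hX0]
  · rwa [key (hDC j₀ γ) (hDt j₀)]

/-- A relation algebraic over `k(t)` with `t` an exponential gives one algebraic over `k`. -/
theorem HasRel.of_adjoin_exp {t R : U} (hkF : k ≤ F)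
    (hconst : ∀ a ∈ F, (∀ j, D j a = 0) → ∃ z : ℂ, algebraMap ℂ U z = a)
    (hDC : ∀ j z, D j (algebraMap ℂ U z) = 0) (hXC : ∀ z, X (algebraMap ℂ U z) = 0)
    (hDk : ∀ j, ∀ a ∈ k, D j a ∈ k) (hXk : ∀ a ∈ k, X a ∈ k)
    (htF : t ∈ F) (ht : Transcendental k t) (hR : R ∈ k)
    (hDt : ∀ j, D j t = t * D j R) (hXt : X t = t * X R)
    (h : HasRel X D {a | a ∈ F ∧ IsAlgebraic k⟮t⟯ a}) : HasRel X D (relAlg k F) := by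
  obtain ⟨m, c, u, v, hu, hv, hX0, j₀, hj₀⟩ := h
  obtain ⟨δ', hδ', hδt'⟩ := exists_derivation_eq_one ht
  have ht0 : t ≠ 0 := fun h => ht (h ▸ isAlgebraic_zero)
  obtain ⟨δ, hδ, hδt⟩ : ∃ δ : Derivation ℚ U U, (∀ a : k, δ (algebraMap k U a) = 0) ∧ δ t = t :=
    ⟨t • δ', fun a => by rw [Derivation.smul_apply, hδ', smul_zero], by simp [hδt']⟩
  have hk (a : U) (ha : a ∈ k) : a ∈ k⟮t⟯ := k⟮t⟯.algebraMap_mem ⟨a, ha⟩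
  have htk : t ∈ k⟮t⟯ := IntermediateField.mem_adjoin_simple_self k t
  obtain ⟨hgF, hga, hgX⟩ := logForm_first_integral hXC hXk hkF htF hδ (by rwa [hδt])
    (by
      have : δ (X R) = 0 := hδ ⟨X R, hXk R hR⟩
      rw [hδt, hXt, Derivation.leibniz, this, hδt]
      simp [mul_comm]) hu hv hX0
  by_cases hgD : ∃ j, D j (logForm δ c u v) ≠ 0
  · obtain ⟨j, hj⟩ := hgD
    obtain ⟨z, hz, hz0, hzj⟩ := exists_first_integral_mem hXk (hDk j)
      (hXt ▸ mul_mem htk (hk _ (hXk R hR))) (hDt j ▸ mul_mem htk (hk _ (hDk j R hR))) hga hgX hj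
    obtain ⟨d, hd⟩ := exists_derivation_comp (k := k) (δ := X) fun a => ⟨⟨X a, hXk a a.2⟩, rfl⟩
    refine hasRel_of_exp hkF (fun a ha h => ?_) htF ht hR hDt hXt hd hz hz0 hzj
    obtain ⟨γ, rfl⟩ := hconst a ha h
    exact k.algebraMap_mem γ
  push Not at hgD
  obtain ⟨γ, hγ⟩ := hconst _ hgF hgD
  have hta : IsAlgebraic k⟮t⟯ t := isAlgebraic_algebraMap (⟨t, htk⟩ : k⟮t⟯)
  obtain ⟨r, c', u', hc', hu', hlog⟩ := exists_linearIndependent_logForm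
    (Fin.cons (-γ) c : Fin (m + 1) → ℂ) (Fin.cons t u : Fin (m + 1) → U)
    (relAlg (k⟮t⟯.restrictScalars ℂ) F) fun i => by
      refine Fin.cases ?_ (fun i => ?_) i
      · exact ⟨mem_relAlg.2 ⟨htF, hta⟩, ht0⟩
      · exact ⟨mem_relAlg.2 (hu i).1, (hu i).2⟩
  have hu'' (i) : u' i ∈ F ∧ IsAlgebraic k⟮t⟯ (u' i) := mem_relAlg.1 (hu' i).1
  have hlin (Y : Derivation ℚ U U) (w : U) :
      logForm Y c' u' w = logForm Y c u w - algebraMap ℂ U γ * (Y t / t) := by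
    rw [hlog, logForm, logForm, Fin.sum_univ_succ]
    simp only [Fin.cons_zero, Fin.cons_succ, map_neg]
    ring
  obtain ⟨hu'a, hva⟩ := logForm_isAlgebraic hδ (by rwa [hδt]) hc' (fun i => (hu'' i).2)
    (fun i => (hu' i).2) hv.2 (by rw [hlin, ← hγ, hδt, div_self ht0, mul_one, sub_self])
  have key {Y : Derivation ℚ U U} (hY : Y (algebraMap ℂ U γ) = 0) (hYt : Y t = t * Y R) :
      logForm Y c' u' (v + algebraMap ℂ U γ * R) = logForm Y c u v := by
    rw [hlin, hYt, mul_div_cancel_left₀ _ ht0]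
    simp [logForm, hY]
    ring
  refine ⟨r, c', u', v + algebraMap ℂ U γ * R, fun i => ⟨mem_relAlg.2 ⟨(hu'' i).1, hu'a i⟩,
    (hu' i).2⟩, ?_, ?_, j₀, ?_⟩
  · exact add_mem (mem_relAlg.2 ⟨hv.1, hva⟩) 
      (mul_mem (IntermediateField.algebraMap_mem _ γ) (coe_mem_relAlg hkF ⟨R, hR⟩))
  · rw [key (hXC γ) hXt, hX0]
  · rwa [key (hDC j₀ γ) (hDt j₀)]

end Step

section Elementary

theorem exists_algebraMap_eq_of_der_eq_zero {N : ℕ} {x : Fin N → U} {D : Fin N → Derivation ℚ U U}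
    (hD : ∀ i j, D i (x j) = if i = j then 1 else 0) (hDC : ∀ i (z : ℂ), D i (algebraMap ℂ U z) = 0)
    {a : U} (ha : a ∈ IntermediateField.adjoin ℂ (Set.range x)) (h : ∀ j, D j a = 0) :
    ∃ z : ℂ, algebraMap ℂ U z = a := by
  by_cases hat : IsAlgebraic ℂ a
  · exact minpoly.mem_range_of_degree_eq_one ℂ a
      (IsAlgClosed.degree_eq_one_of_irreducible ℂ (minpoly.irreducible hat.isIntegral))
  obtain ⟨δ, hδ, hδa⟩ := exists_derivation_eq_one hat
  have h1 (b : U) : (∑ j, δ (x j) • D j : Derivation ℚ U U) b = ∑ j, δ (x j) * D j b := by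
    rw [← Derivation.coeFnAddMonoidHom_apply, map_sum, Finset.sum_apply]
    rfl
  have : δ a = _ := der_eq_of_isAlgebraic_adjoin (k := ℂ) (S := Set.range x) (δ := δ)
    (ε := ∑ j, δ (x j) • D j) (fun z => by rw [h1, hδ]; simp [hDC])
    (by rintro _ ⟨i, rfl⟩; rw [h1]; simp [hD])
    (isAlgebraic_algebraMap (⟨a, ha⟩ : IntermediateField.adjoin ℂ (Set.range x)))
  rw [h1, hδa] at this
  simp [h] at this

variable {N : ℕ} {D : Fin N → Derivation ℚ U U} {k l F : IntermediateField ℂ U}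

theorem ElemStep.le (h : ElemStep D k l) : k ≤ l := by
  cases h <;> exact fun a ha => IntermediateField.subset_adjoin _ _ (Or.inl ha)

theorem le_of_reflTransGen_elemStep (h : Relation.ReflTransGen (ElemStep D) k l) : k ≤ l := by
  induction h with
  | refl => exact le_rfl
  | tail _ h ih => exact ih.trans h.le

theorem ElemStep.exists_eq (h : ElemStep D k l) :
    ∃ t, l = k⟮t⟯.restrictScalars ℂ ∧ (IsAlgebraic k t ∨
      (∃ R ∈ k, t ≠ 0 ∧ ∀ j, D j t = t * D j R) ∨ ∃ R ∈ k, R ≠ 0 ∧ ∀ j, D j t = D j R / R) := by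
  cases h with
  | exp t R hR ht h =>
    exact ⟨t, by rw [IntermediateField.restrictScalars_adjoin], .inr (.inl ⟨R, hR, ht, h⟩)⟩
  | log t R hR ht h =>
    exact ⟨t, by rw [IntermediateField.restrictScalars_adjoin], .inr (.inr ⟨R, hR, ht, h⟩)⟩
  | alg t h => exact ⟨t, by rw [IntermediateField.restrictScalars_adjoin], .inl h⟩

theorem ElemStep.der_mem (h : ElemStep D k l) (hk : ∀ j, ∀ a ∈ k, D j a ∈ k) (j : Fin N) (a : U)
    (ha : a ∈ l) : D j a ∈ l := by
  obtain ⟨t, rfl, ht⟩ := h.exists_eq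
  have hk' (a : U) (ha : a ∈ k) : a ∈ k⟮t⟯ := k⟮t⟯.algebraMap_mem ⟨a, ha⟩
  have htk : t ∈ k⟮t⟯ := IntermediateField.mem_adjoin_simple_self k t
  refine der_mem_adjoin_of_mem (k := k) (S := {t}) (fun b => hk' _ (hk j b b.2)) ?_ ha
  rintro _ rfl
  rcases ht with ht | ⟨R, hR, -, hR'⟩ | ⟨R, hR, -, hR'⟩
  · obtain ⟨d, hd⟩ := exists_derivation_comp (k := k) (δ := D j) fun a => ⟨⟨D j a, hk j a a.2⟩, rfl⟩
    exact der_mem_adjoin hd ht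
  · exact hR' j ▸ mul_mem htk (hk' _ (hk j R hR))
  · exact hR' j ▸ hk' _ (div_mem (hk j R hR) hR)

theorem HasRel.mono {X : Derivation ℚ U U} {S T : Set U} (h : HasRel X D S) (hST : S ⊆ T) :
    HasRel X D T := by
  obtain ⟨m, c, u, v, hu, hv, h⟩ := h
  exact ⟨m, c, u, v, fun i => ⟨hST (hu i).1, (hu i).2⟩, hST hv, h⟩

theorem isAlgebraic_of_isAlgebraic_adjoin {t a : U} (ht : IsAlgebraic k t)
    (ha : IsAlgebraic k⟮t⟯ a) : IsAlgebraic k a := by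
  have := isAlgebraic_adjoin_simple ht.isIntegral
  exact ha.restrictScalars k

theorem HasRel.of_reflTransGen_elemStep {X : Derivation ℚ U U} {q : Fin N → U}
    (hX : ∀ a, X a = ∑ j, q j * D j a)
    (hconst : ∀ a ∈ F, (∀ j, D j a = 0) → ∃ z : ℂ, algebraMap ℂ U z = a)
    (hDC : ∀ j z, D j (algebraMap ℂ U z) = 0) (h : HasRel X D F)
    (hkF : Relation.ReflTransGen (ElemStep D) k F) (hqk : ∀ j, q j ∈ k)
    (hDk : ∀ j, ∀ a ∈ k, D j a ∈ k) : HasRel X D (relAlg k F) := by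
  have hXC (z : ℂ) : X (algebraMap ℂ U z) = 0 := by simp [hX, hDC]
  induction hkF using Relation.ReflTransGen.head_induction_on with
  | refl => exact h.mono fun a ha => coe_mem_relAlg le_rfl ⟨a, ha⟩
  | @head k l hkl hlF ih =>
    have ih := ih (fun j => hkl.le (hqk j)) (hkl.der_mem hDk)
    have hlF' := le_of_reflTransGen_elemStep hlF
    have hkF := hkl.le.trans hlF'
    have hXk (a : U) (ha : a ∈ k) : X a ∈ k := by
      rw [hX]
      exact sum_mem fun j _ => mul_mem (hqk j) (hDk j a ha)
    obtain ⟨t, rfl, ht⟩ := hkl.exists_eq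
    have htF : t ∈ F := hlF' (IntermediateField.mem_adjoin_simple_self k t)
    by_cases hta : IsAlgebraic k t
    · refine ih.mono fun a ha => ?_
      rw [SetLike.mem_coe, mem_relAlg] at ha ⊢
      exact ⟨ha.1, isAlgebraic_of_isAlgebraic_adjoin hta ha.2⟩
    have ih' : HasRel X D {a | a ∈ F ∧ IsAlgebraic k⟮t⟯ a} := ih.mono fun a ha => mem_relAlg.1 ha
    rcases ht with ht | ⟨R, hR, -, hDt⟩ | ⟨R, hR, hR0, hDt⟩
    · exact absurd ht hta
    · refine ih'.of_adjoin_exp hkF hconst hDC hXC hDk hXk htF hta hR hDt ?_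
      simp only [hX, hDt, Finset.mul_sum]
      exact Finset.sum_congr rfl fun j _ => by ring
    · refine ih'.of_adjoin_log hkF hconst hDC hXC hDk hXk htF hta hR hR0 hDt ?_
      simp only [hX, hDt, Finset.sum_div]
      exact Finset.sum_congr rfl fun j _ => by ring

end Elementary

end Auxiliary

/-- Prelle–Singer theorem. If a Prelle–Singer relation for the
(N−1)-form Ω over K = ℂ(x₁,…,x_N) holds over an elementary extension F of K, then it
holds over some finite algebraic extension of K contained in F. -/
theorem prelle_singer_elementary_to_algebraic
    {N : ℕ} (x : Fin N → U) (D : Fin N → Derivation ℚ U U)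
    (hind : AlgebraicIndependent ℂ x)
    (hD : ∀ i j, D i (x j) = if i = j then 1 else 0)
    (hDC : ∀ i (z : ℂ), D i (algebraMap ℂ U z) = 0)
    (hcomm : ∀ i j a, D i (D j a) = D j (D i a))
    (K : IntermediateField ℂ U) (hK : K = IntermediateField.adjoin ℂ (Set.range x))
    (P : Fin N → U) (hP : ∀ j, P j ∈ K)
    (F : IntermediateField ℂ U) (hF : IsElementary D K F)
    (m : ℕ) (c : Fin m → ℂ) (u : Fin m → U) (v : U)
    (hu : ∀ i, u i ∈ F) (hv : v ∈ F)
    (hPS : IsPSRel D P (fun i => algebraMap ℂ U (c i)) u v) :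
    ∃ Ft : IntermediateField ↥K U, (Ft : Set U) ⊆ (F : Set U) ∧
      FiniteDimensional ↥K ↥Ft ∧
      ∃ (m' : ℕ) (c' : Fin m' → ℂ) (u' : Fin m' → U) (v' : U),
        (∀ i, u' i ∈ Ft) ∧ v' ∈ Ft ∧
        IsPSRel D P (fun i => algebraMap ℂ U (c' i)) u' v' := by
  obtain ⟨hKF, hFK⟩ := hF
  have hconst (a : U) (ha : a ∈ F) (h : ∀ j, D j a = 0) : ∃ z : ℂ, algebraMap ℂ U z = a :=
    exists_algebraMap_eq_of_der_eq_zero hD hDC (hK ▸ hFK a ha h) h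
  have hDK (j : Fin N) (a : U) (ha : a ∈ K) : D j a ∈ K := by
    subst hK
    refine der_mem_adjoin_of_mem (fun z => by rw [hDC]; exact zero_mem _) ?_ ha
    rintro _ ⟨i, rfl⟩
    rw [hD]
    split_ifs
    exacts [one_mem _, zero_mem _]
  let q (j : Fin N) : U := (-1) ^ (j : ℕ) * P j
  let X : Derivation ℚ U U := ∑ j, q j • D j
  have hX (a : U) : X a = ∑ j, q j * D j a := by
    rw [← Derivation.coeFnAddMonoidHom_apply, map_sum, Finset.sum_apply]
    rfl
  have hlog {m : ℕ} (c : Fin m → ℂ) (u : Fin m → U) (v : U) : logForm X c u v =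
      ∑ j : Fin N, (-1 : U) ^ (j : ℕ) * P j * psCoeff D (fun i => algebraMap ℂ U (c i)) u v j := by
    simp only [logForm, psCoeff, hX, mul_add, Finset.sum_add_distrib, Finset.mul_sum,
      Finset.sum_div]
    rw [Finset.sum_comm]
    congr 1
    exact Finset.sum_congr rfl fun j _ => Finset.sum_congr rfl fun i _ => by ring
  obtain ⟨hu0, hPS0, hPS1⟩ := hPS
  obtain ⟨m', c', u', v', hu', hv', hX', hD'⟩ := HasRel.of_reflTransGen_elemStep hX hconst hDC
    ⟨m, c, u, v, fun i => ⟨hu i, hu0 i⟩, hv, (hlog c u v).trans hPS0, hPS1⟩ hKF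
    (fun j => mul_mem (pow_mem (neg_mem (one_mem K)) _) (hP j)) hDK
  let S : Set U := insert v' (Set.range u')
  have hS (a : U) (ha : a ∈ S) : a ∈ F ∧ IsAlgebraic K a := by
    rcases ha with rfl | ⟨i, rfl⟩
    exacts [mem_relAlg.1 hv', mem_relAlg.1 (hu' i).1]
  refine ⟨IntermediateField.adjoin K S, fun a ha => ?_, ?_, m', c', u', v',
    fun i => IntermediateField.subset_adjoin _ _ (Set.mem_insert_of_mem _ ⟨i, rfl⟩),
    IntermediateField.subset_adjoin _ _ (Set.mem_insert _ _),
    fun i => (hu' i).2, (hlog c' u' v').symm.trans hX', hD'⟩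
  · have ha' : a ∈ (IntermediateField.adjoin K S).restrictScalars ℂ := ha
    rw [IntermediateField.restrictScalars_adjoin] at ha'
    exact IntermediateField.adjoin_le_iff.2 (Set.union_subset (le_of_reflTransGen_elemStep hKF)
      fun b hb => (hS b hb).1) ha'
  · have : Finite S := ((Set.finite_range u').insert v').to_subtype
    exact IntermediateField.finiteDimensional_adjoin fun b hb => (hS b hb).2.isIntegral
end
end

section
/- Let K = ℂ(x,y) and let ω = P dx + Q dy be a nonzero one-form over K which is exceptional. Let M be a finite Galois extension of K over which a Prelle–Singer relation for ω holds, with ℓ ∈ M∖{0} satisfying Σᵢ cᵢ duᵢ/uᵢ + dv = ℓω, and let L ⊆ M be minimal among algebraic extensions of K over which such a relation holds. Then: (a) L = K(ℓ) and L is a Galois extension of K whose Galois group G is cyclic, G ≅ ℤ/nℤ with n = [L:K]; (b) there is a primitive n-th root of unity ζ such that τ(ℓ) = ζℓ for a generator τ of G, and ℓⁿ = k for some k ∈ K, i.e. ℓ is an n-th root of an element of K. -/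
noncomputable section

/-- Coefficient (w.r.t. the derivation `D`) of the one-form  Σᵢ cᵢ duᵢ/uᵢ + dv. -/
def psC {M : Type} [Field M] [CharZero M] (D : Derivation ℚ M M)
    {m : ℕ} (c u : Fin m → M) (v : M) : M :=
  (∑ i, c i * (D (u i) / u i)) + D v

/-- Prelle–Singer relation for the one-form ω = P dx + Q dy:
`(Σᵢ cᵢ duᵢ/uᵢ + dv) ∧ ω = 0` and `Σᵢ cᵢ duᵢ/uᵢ + dv ≠ 0`. -/
def PSRel {M : Type} [Field M] [CharZero M] (DX DY : Derivation ℚ M M)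
    (P Q : M) {m : ℕ} (c u : Fin m → M) (v : M) : Prop :=
  (∀ i, u i ≠ 0) ∧
  psC DX c u v * Q - psC DY c u v * P = 0 ∧
  (psC DX c u v ≠ 0 ∨ psC DY c u v ≠ 0)

variable (K : Type) [Field K] [CharZero K] [Algebra ℂ K]

/-- A finite algebraic differential extension of the differential field `(K, Dx, Dy)`. -/
structure DiffExt (Dx Dy : Derivation ℚ K K) : Type 1 where
  M : Type
  [fieldM : Field M]
  [charM : CharZero M]
  [algM : Algebra K M]
  finite : FiniteDimensional K M
  DX : Derivation ℚ M M
  DY : Derivation ℚ M M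
  extX : ∀ a : K, DX (algebraMap K M a) = algebraMap K M (Dx a)
  extY : ∀ a : K, DY (algebraMap K M a) = algebraMap K M (Dy a)

attribute [instance] DiffExt.fieldM DiffExt.charM DiffExt.algM

variable {K}

/-- A Prelle–Singer relation for ω = P dx + Q dy over the extension `E`. -/
def HasPSRel {Dx Dy : Derivation ℚ K K} (E : DiffExt K Dx Dy) (P Q : K) : Prop :=
  ∃ (m : ℕ) (c : Fin m → ℂ) (u : Fin m → E.M) (v : E.M),
    PSRel E.DX E.DY (algebraMap K E.M P) (algebraMap K E.M Q)
      (fun i => algebraMap K E.M (algebraMap ℂ K (c i))) u v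

/-- A Prelle–Singer relation for ω with all data in `K` itself. -/
def HasPSRelBase (Dx Dy : Derivation ℚ K K) (P Q : K) : Prop :=
  ∃ (m : ℕ) (c : Fin m → ℂ) (u : Fin m → K) (v : K),
    PSRel Dx Dy P Q (fun i => algebraMap ℂ K (c i)) u v

/-- ω = P dx + Q dy is exceptional: some Prelle–Singer relation holds over a finite
algebraic extension of `K`, but none holds with all data in `K` itself. -/
def IsExceptional (Dx Dy : Derivation ℚ K K) (P Q : K) : Prop :=
  (∃ E : DiffExt K Dx Dy, HasPSRel E P Q) ∧ ¬ HasPSRelBase Dx Dy P Q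

/-- A Prelle–Singer relation with all data inside the intermediate field `L`. -/
def RelIn {Dx Dy : Derivation ℚ K K} (E : DiffExt K Dx Dy) (P Q : K)
    (L : IntermediateField K E.M) : Prop :=
  ∃ (m : ℕ) (c : Fin m → ℂ) (u : Fin m → E.M) (v : E.M),
    (∀ i, u i ∈ L) ∧ v ∈ L ∧
    PSRel E.DX E.DY (algebraMap K E.M P) (algebraMap K E.M Q)
      (fun i => algebraMap K E.M (algebraMap ℂ K (c i))) u v

open Polynomial in
/-- The polynomial obtained by applying a derivation to all coefficients. -/
def coeffDeriv {F : Type} [Field F] [CharZero F] (d : Derivation ℚ F F) (p : F[X]) : F[X] :=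
  p.sum fun n a => monomial n (d a)

open Polynomial in
lemma coeff_coeffDeriv {F : Type} [Field F] [CharZero F] (d : Derivation ℚ F F) (p : F[X])
    (n : ℕ) : (coeffDeriv d p).coeff n = d (p.coeff n) := by
  simp only [coeffDeriv, Polynomial.sum, finsetSum_coeff, coeff_monomial, Finset.sum_ite_eq',
    mem_support_iff]
  by_cases h : p.coeff n = 0 <;> simp [h]

open Polynomial in
lemma coeffDeriv_add {F : Type} [Field F] [CharZero F] (d : Derivation ℚ F F) (p q : F[X]) :
    coeffDeriv d (p + q) = coeffDeriv d p + coeffDeriv d q := by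
  ext n
  simp [coeff_coeffDeriv]

open Polynomial in
lemma coeffDeriv_monomial {F : Type} [Field F] [CharZero F] (d : Derivation ℚ F F) (n : ℕ)
    (a : F) : coeffDeriv d (monomial n a) = monomial n (d a) := by
  ext k
  simp only [coeff_coeffDeriv, coeff_monomial]
  split_ifs <;> simp

open Polynomial in
lemma aeval_derivative_minpoly_ne_zero_s5 {F M : Type} [Field F] [CharZero F] [Field M]
    [Algebra F M] [Algebra.IsAlgebraic F M] (f : M) :
    aeval f (derivative (minpoly F f)) ≠ 0 :=
  (minpoly.irreducible (Algebra.IsIntegral.isIntegral f)).separable.aeval_derivative_ne_zero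
    (minpoly.aeval F f)

section AlgebraicExtension

variable {F M : Type} [Field F] [CharZero F] [Field M] [CharZero M] [Algebra F M]
  {d : Derivation ℚ F F} {D : Derivation ℚ M M}

open Polynomial in
lemma deriv_aeval (hD : ∀ a, D (algebraMap F M a) = algebraMap F M (d a)) (f : M) (p : F[X]) :
    D (aeval f p) = aeval f (coeffDeriv d p) + aeval f (derivative p) * D f := by
  induction p using Polynomial.induction_on' with
  | add p q hp hq => simp only [map_add, coeffDeriv_add, hp, hq]; ring
  | monomial n a =>
    simp only [aeval_monomial, Derivation.leibniz, Derivation.leibniz_pow, coeffDeriv_monomial,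
      derivative_monomial, map_mul, map_natCast, hD, smul_eq_mul, nsmul_eq_mul]
    ring

open Polynomial in
lemma deriv_eq_div [Algebra.IsAlgebraic F M]
    (hD : ∀ a, D (algebraMap F M a) = algebraMap F M (d a)) (f : M) :
    D f = -aeval f (coeffDeriv d (minpoly F f)) / aeval f (derivative (minpoly F f)) := by
  have h := deriv_aeval hD f (minpoly F f)
  rw [minpoly.aeval, map_zero] at h
  rw [eq_div_iff (aeval_derivative_minpoly_ne_zero_s5 f)]
  linear_combination -h

lemma deriv_mem_intermediateField [Algebra.IsAlgebraic F M]
    (hD : ∀ a, D (algebraMap F M a) = algebraMap F M (d a)) {L : IntermediateField F M} {f : M}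
    (hf : f ∈ L) : D f ∈ L := by
  rw [deriv_eq_div hD]
  have key : ∀ p : Polynomial F, Polynomial.aeval f p ∈ L := fun p => by
    have := (Polynomial.aeval (⟨f, hf⟩ : L) p).2
    rwa [← IntermediateField.coe_val, ← AlgHom.coe_toRingHom, AlgHom.coe_toRingHom,
      ← Polynomial.aeval_algHom_apply] at this
  exact L.div_mem (L.neg_mem (key _)) (key _)

lemma algEquiv_deriv_apply [Algebra.IsAlgebraic F M]
    (hD : ∀ a, D (algebraMap F M a) = algebraMap F M (d a)) (σ : M ≃ₐ[F] M) (f : M) :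
    σ (D f) = D (σ f) := by
  rw [deriv_eq_div hD f, deriv_eq_div hD (σ f), minpoly.algEquiv_eq, map_div₀, map_neg,
    Polynomial.aeval_algHom_apply, Polynomial.aeval_algHom_apply]

lemma deriv_eq_zero_of_algebraMap [Algebra.IsAlgebraic F M]
    (hD : ∀ a, D (algebraMap F M a) = 0) (f : M) : D f = 0 := by
  have h0 : ∀ p : Polynomial F, coeffDeriv (0 : Derivation ℚ F F) p = 0 := fun p => by
    ext n; simp [coeff_coeffDeriv]
  rw [deriv_eq_div (F := F) (d := 0) (by simpa using hD) f, h0]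
  simp

lemma deriv_coeff_minpoly_eq_zero [Algebra.IsAlgebraic F M]
    (hD : ∀ a, D (algebraMap F M a) = algebraMap F M (d a)) {f : M} (hf : D f = 0) (n : ℕ) :
    d ((minpoly F f).coeff n) = 0 := by
  have hint : IsIntegral F f := Algebra.IsIntegral.isIntegral f
  have h := deriv_aeval hD f (minpoly F f)
  rw [minpoly.aeval, map_zero, hf, mul_zero, add_zero] at h
  suffices coeffDeriv d (minpoly F f) = 0 by rw [← coeff_coeffDeriv, this, Polynomial.coeff_zero]
  by_contra hne
  refine absurd (minpoly.degree_le_of_ne_zero F f hne h.symm) (not_le.2 ?_)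
  rw [Polynomial.degree_eq_natDegree (minpoly.ne_zero hint), Polynomial.degree_lt_iff_coeff_zero]
  intro k hk
  rw [coeff_coeffDeriv]
  rcases hk.eq_or_lt with rfl | hk
  · rw [(minpoly.monic hint).coeff_natDegree, Derivation.map_one_eq_zero]
  · rw [Polynomial.coeff_eq_zero_of_natDegree_lt hk, map_zero]

end AlgebraicExtension

lemma deriv_prod_div_prod {M ι : Type} [Field M] [CharZero M] (D : Derivation ℚ M M)
    (s : Finset ι) (f : ι → M) (hf : ∀ i ∈ s, f i ≠ 0) :
    D (∏ i ∈ s, f i) / ∏ i ∈ s, f i = ∑ i ∈ s, D (f i) / f i := by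
  classical
  induction s using Finset.induction_on with
  | empty => simp
  | insert a s ha ih =>
    have h1 : f a ≠ 0 := hf a (by simp)
    have h2 : ∏ i ∈ s, f i ≠ 0 :=
      Finset.prod_ne_zero_iff.2 fun i hi => hf i (Finset.mem_insert_of_mem hi)
    rw [Finset.prod_insert ha, Finset.sum_insert ha,
      ← ih fun i hi => hf i (Finset.mem_insert_of_mem hi), Derivation.leibniz]
    simp only [smul_eq_mul]
    field_simp
    ring

lemma mem_range_algebraMap_of_deriv_eq_zero {K : Type} [Field K] [CharZero K] [Algebra ℂ K]
    {x y : K} {Dx Dy : Derivation ℚ K K}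
    (hxx : Dx x = 1) (hyy : Dy y = 1)
    (hxy : Dx y = 0) (hyx : Dy x = 0)
    (hDxC : ∀ z : ℂ, Dx (algebraMap ℂ K z) = 0)
    (hDyC : ∀ z : ℂ, Dy (algebraMap ℂ K z) = 0)
    (hgen : IntermediateField.adjoin ℂ {x, y} = ⊤)
    (hind : AlgebraicIndependent ℂ ![x, y])
    {a : K} (hax : Dx a = 0) (hay : Dy a = 0) : a ∈ (algebraMap ℂ K).range := by
  by_contra hmem
  have htr : Transcendental ℂ a := fun halg => hmem <|
    minpoly.mem_range_of_degree_eq_one ℂ a <|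
      IsAlgClosed.degree_eq_one_of_irreducible ℂ (minpoly.irreducible halg.isIntegral)
  have halg : ∀ s : Set K, {x, y} ⊆ s → Algebra.IsAlgebraic (Algebra.adjoin ℂ s) K := by
    intro s hs
    refine ⟨fun z => ?_⟩
    have hz : z ∈ IntermediateField.adjoin ℂ {x, y} := hgen ▸ IntermediateField.mem_top
    obtain ⟨r, hr, t, ht, rfl⟩ := IntermediateField.mem_adjoin_iff_div.1 hz
    have key : ∀ w ∈ Algebra.adjoin ℂ {x, y}, IsAlgebraic (Algebra.adjoin ℂ s) w := fun w hw =>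
      isAlgebraic_algebraMap (⟨w, Algebra.adjoin_mono hs hw⟩ : Algebra.adjoin ℂ s)
    rw [div_eq_mul_inv]
    exact (key r hr).mul (key t ht).inv
  have hrange : Set.range ![x, y] = {x, y} := by simp [Set.pair_comm]
  have hbasis : IsTranscendenceBasis ℂ ![x, y] :=
    hind.isTranscendenceBasis_iff_isAlgebraic.2 (halg _ hrange.ge)
  have hB : ∃ B : Set K, {a} ⊆ B ∧ B ⊆ {a, x, y} ∧ IsTranscendenceBasis ℂ ((↑) : B → K) := by
    have := halg {a, x, y} (Set.subset_insert _ _)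
    exact exists_isTranscendenceBasis_between _ _ (by simp) (by
      simpa [AlgebraicIndepOn, algebraicIndependent_unique_type_iff] using htr)
  obtain ⟨B, haB, hBs, hB⟩ := hB
  have hkill : ∀ D : Derivation ℚ K K, (∀ z : ℂ, D (algebraMap ℂ K z) = 0) →
      (∀ b ∈ B, D b = 0) → ∀ z, D z = 0 := by
    intro D hDC hDB
    have := hB.isAlgebraic_field
    refine deriv_eq_zero_of_algebraMap
      (F := IntermediateField.adjoin ℂ (Set.range ((↑) : B → K))) ?_
    rintro ⟨z, hz⟩
    change D z = 0
    induction hz using IntermediateField.adjoin_induction with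
    | mem z hz => exact hDB z (by simpa using hz)
    | algebraMap z => exact hDC z
    | add z w _ _ hz hw => rw [map_add, hz, hw, add_zero]
    | inv z _ hz => simp [Derivation.leibniz_inv, hz]
    | mul z w _ _ hz hw => simp [hz, hw]
  by_cases hx : x ∈ B
  · by_cases hy : y ∈ B
    · have hle : Set.range ![x, y] ≤ B := by
        rw [hrange]
        rintro _ (rfl | rfl) <;> assumption
      have := hbasis.2 B hB.1 hle
      have ha : a ∈ ({x, y} : Set K) := by
        rw [← hrange, this]
        exact haB rfl
      rcases ha with rfl | rfl
      · simp [hxx] at hax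
      · simp [hyy] at hay
    · have := hkill Dy hDyC (fun b hb => by
        rcases hBs hb with rfl | rfl | rfl
        · exact hay
        · exact hyx
        · exact absurd hb hy) y
      simp [hyy] at this
  · have := hkill Dx hDxC (fun b hb => by
      rcases hBs hb with rfl | rfl | rfl
      · exact hax
      · exact absurd hb hx
      · exact hxy) x
    simp [hxx] at this

lemma deriv_psC_comm {M : Type} [Field M] [CharZero M] {DX DY : Derivation ℚ M M}
    (hcomm : ∀ f, DX (DY f) = DY (DX f)) {m : ℕ} {c u : Fin m → M} {v : M}
    (hcX : ∀ i, DX (c i) = 0) (hcY : ∀ i, DY (c i) = 0) (hu : ∀ i, u i ≠ 0) :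
    DY (psC DX c u v) = DX (psC DY c u v) := by
  simp only [psC, map_add, map_sum, hcomm]
  congr 1
  refine Finset.sum_congr rfl fun i _ => ?_
  have := hu i
  simp only [Derivation.leibniz, Derivation.leibniz_div, hcX, hcY, smul_eq_mul, hcomm]
  ring

section Extension

variable {K : Type} [Field K] [CharZero K] {Dx Dy : Derivation ℚ K K}

lemma deriv_comm_of_algebraMap (hcomm : ∀ a, Dx (Dy a) = Dy (Dx a)) (E : DiffExt K Dx Dy)
    (f : E.M) : E.DX (E.DY f) = E.DY (E.DX f) := by
  have := E.finite
  rw [← sub_eq_zero, ← Derivation.commutator_apply]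
  refine deriv_eq_zero_of_algebraMap (F := K) (fun a => ?_) f
  rw [Derivation.commutator_apply, E.extX, E.extY, E.extX, E.extY, hcomm, sub_self]

variable [Algebra ℂ K]

/-- A first integral of `ω` in a finite extension of `K` is a constant. -/
lemma exists_complex_eq_of_firstIntegral
    (hconst : ∀ a, Dx a = 0 → Dy a = 0 → a ∈ (algebraMap ℂ K).range)
    {P Q : K} (hbase : ¬ HasPSRelBase Dx Dy P Q) (E : DiffExt K Dx Dy) {f : E.M}
    (hf : algebraMap K E.M Q * E.DX f - algebraMap K E.M P * E.DY f = 0) :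
    ∃ z : ℂ, f = algebraMap K E.M (algebraMap ℂ K z) := by
  have := E.finite
  have hint : IsIntegral K f := Algebra.IsIntegral.isIntegral f
  have hK : ∀ g : K, Q * Dx g - P * Dy g = 0 → g ∈ (algebraMap ℂ K).range := by
    intro g hg
    by_contra hgC
    refine hbase ⟨0, Fin.elim0, Fin.elim0, g, fun i => i.elim0, ?_, ?_⟩
    · simp only [psC, Finset.univ_eq_empty, Finset.sum_empty, zero_add]
      linear_combination hg
    · simp only [psC, Finset.univ_eq_empty, Finset.sum_empty, zero_add]
      by_contra! h
      exact hgC (hconst g h.1 h.2)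
  have hcoeff : ∀ n, (minpoly K f).coeff n ∈ (algebraMap ℂ K).range := fun n => hK _ <| by
    have := deriv_coeff_minpoly_eq_zero (F := K) (d := Q • Dx - P • Dy)
      (D := algebraMap K E.M Q • E.DX - algebraMap K E.M P • E.DY)
      (fun a => by simp [E.extX, E.extY, Algebra.smul_def]) (f := f)
      (by simpa [Algebra.smul_def] using hf) n
    simpa using this
  obtain ⟨q, hq, hdeg, -⟩ := Polynomial.lifts_and_degree_eq_and_monic
    ((Polynomial.lifts_iff_coeff_lifts _).2 hcoeff) (minpoly.monic hint)
  obtain ⟨z, hz⟩ := IsAlgClosed.exists_root q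
    (by rw [hdeg]; exact (minpoly.degree_pos hint).ne')
  have hroot : (minpoly K f).IsRoot (algebraMap ℂ K z) := hq ▸ hz.map
  obtain ⟨a, rfl⟩ := minpoly.mem_range_of_degree_eq_one K f
    (Polynomial.degree_eq_one_of_irreducible_of_root (minpoly.irreducible hint) hroot)
  obtain ⟨w, rfl⟩ := hK a <| by
    apply (algebraMap K E.M).injective
    simpa [E.extX, E.extY] using hf
  exact ⟨w, rfl⟩

/-- Two integrating factors of `ω` are proportional. -/
lemma exists_complex_mul_eq_of_closed
    (hconst : ∀ a, Dx a = 0 → Dy a = 0 → a ∈ (algebraMap ℂ K).range)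
    {P Q : K} (hbase : ¬ HasPSRelBase Dx Dy P Q) (E : DiffExt K Dx Dy) {f g : E.M}
    (hf0 : f ≠ 0)
    (hf : E.DY (f * algebraMap K E.M P) = E.DX (f * algebraMap K E.M Q))
    (hg : E.DY (g * algebraMap K E.M P) = E.DX (g * algebraMap K E.M Q)) :
    ∃ z : ℂ, g = algebraMap K E.M (algebraMap ℂ K z) * f := by
  obtain ⟨z, hz⟩ := exists_complex_eq_of_firstIntegral hconst hbase E (f := g / f) (by
    simp only [Derivation.leibniz, smul_eq_mul, E.extX, E.extY] at hf hg
    simp only [Derivation.leibniz_div, smul_eq_mul]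
    field_simp
    linear_combination g * hf - f * hg)
  exact ⟨z, by rw [← hz, div_mul_cancel₀ _ hf0]⟩

lemma closed_of_psC_eq_mul (hcomm : ∀ a, Dx (Dy a) = Dy (Dx a))
    (hDxC : ∀ z : ℂ, Dx (algebraMap ℂ K z) = 0) (hDyC : ∀ z : ℂ, Dy (algebraMap ℂ K z) = 0)
    {P Q : K} (E : DiffExt K Dx Dy) {m : ℕ} {c : Fin m → ℂ} {u : Fin m → E.M} {v f : E.M}
    (hu : ∀ i, u i ≠ 0)
    (hX : psC E.DX (fun i => algebraMap K E.M (algebraMap ℂ K (c i))) u v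
      = f * algebraMap K E.M P)
    (hY : psC E.DY (fun i => algebraMap K E.M (algebraMap ℂ K (c i))) u v
      = f * algebraMap K E.M Q) :
    E.DY (f * algebraMap K E.M P) = E.DX (f * algebraMap K E.M Q) := by
  rw [← hX, ← hY]
  exact deriv_psC_comm (deriv_comm_of_algebraMap hcomm E) (fun i => by simp [E.extX, hDxC])
    (fun i => by simp [E.extY, hDyC]) hu

lemma exists_eq_mul_of_relIn {P Q : K} (hω : ¬ (P = 0 ∧ Q = 0)) {E : DiffExt K Dx Dy}
    {L : IntermediateField K E.M} {m : ℕ} {c : Fin m → ℂ} {u : Fin m → E.M} {v : E.M}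
    (hu : ∀ i, u i ∈ L) (hv : v ∈ L)
    (h : PSRel E.DX E.DY (algebraMap K E.M P) (algebraMap K E.M Q)
      (fun i => algebraMap K E.M (algebraMap ℂ K (c i))) u v) :
    ∃ f ∈ L, f ≠ 0 ∧
      psC E.DX (fun i => algebraMap K E.M (algebraMap ℂ K (c i))) u v
        = f * algebraMap K E.M P ∧
      psC E.DY (fun i => algebraMap K E.M (algebraMap ℂ K (c i))) u v
        = f * algebraMap K E.M Q := by
  have := E.finite
  obtain ⟨-, h0, hne⟩ := h
  have hmem : ∀ D : Derivation ℚ E.M E.M, (∀ g ∈ L, D g ∈ L) →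
      psC D (fun i => algebraMap K E.M (algebraMap ℂ K (c i))) u v ∈ L := fun D hD =>
    L.add_mem (L.sum_mem fun i _ => L.mul_mem (L.algebraMap_mem _)
      (L.div_mem (hD _ (hu i)) (hu i))) (hD _ hv)
  have hX := hmem E.DX fun g hg => deriv_mem_intermediateField E.extX hg
  have hY := hmem E.DY fun g hg => deriv_mem_intermediateField E.extY hg
  set tX := psC E.DX (fun i => algebraMap K E.M (algebraMap ℂ K (c i))) u v
  set tY := psC E.DY (fun i => algebraMap K E.M (algebraMap ℂ K (c i))) u v
  have hinj : ∀ a : K, a ≠ 0 → algebraMap K E.M a ≠ 0 := fun a ha => by simpa using ha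
  suffices ∃ f ∈ L, tX = f * algebraMap K E.M P ∧ tY = f * algebraMap K E.M Q by
    obtain ⟨f, hfL, hfX, hfY⟩ := this
    refine ⟨f, hfL, ?_, hfX, hfY⟩
    rintro rfl
    simp [hfX, hfY] at hne
  by_cases hP : P = 0
  · have hQ := hinj Q fun hQ => hω ⟨hP, hQ⟩
    refine ⟨tY / algebraMap K E.M Q, L.div_mem hY (L.algebraMap_mem _), ?_,
      (div_mul_cancel₀ _ hQ).symm⟩
    simpa [hP, hQ] using h0
  · have hP := hinj P hP
    refine ⟨tX / algebraMap K E.M P, L.div_mem hX (L.algebraMap_mem _),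
      (div_mul_cancel₀ _ hP).symm, ?_⟩
    field_simp
    linear_combination -h0

/-- Taking norms and traces down to `K(ℓ)` turns a Prelle–Singer relation with integrating
factor `ℓ` into one with data in `K(ℓ)`. -/
lemma relIn_adjoin_simple {P Q : K} (hω : ¬ (P = 0 ∧ Q = 0)) {E : DiffExt K Dx Dy}
    [IsGalois K E.M] {m : ℕ} {c : Fin m → ℂ} {u : Fin m → E.M} {v ℓ : E.M} (hℓ : ℓ ≠ 0)
    (hu : ∀ i, u i ≠ 0)
    (hX : psC E.DX (fun i => algebraMap K E.M (algebraMap ℂ K (c i))) u v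
      = ℓ * algebraMap K E.M P)
    (hY : psC E.DY (fun i => algebraMap K E.M (algebraMap ℂ K (c i))) u v
      = ℓ * algebraMap K E.M Q) :
    RelIn E P Q (IntermediateField.adjoin K {ℓ}) := by
  classical
  have := E.finite
  set H := (IntermediateField.adjoin K {ℓ}).fixingSubgroup with hH
  have hfix : IntermediateField.fixedField H = IntermediateField.adjoin K {ℓ} :=
    IsGalois.fixedField_fixingSubgroup _
  have hσℓ : ∀ σ : H, σ.1 ℓ = ℓ := fun σ =>
    (IntermediateField.mem_fixingSubgroup_iff _ _).1 σ.2 ℓ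
      (IntermediateField.mem_adjoin_simple_self K ℓ)
  have := Fintype.ofFinite H
  have key : ∀ (D : Derivation ℚ E.M E.M) (R : K),
      (∀ (σ : E.M ≃ₐ[K] E.M) f, σ (D f) = D (σ f)) →
      psC D (fun i => algebraMap K E.M (algebraMap ℂ K (c i))) u v = ℓ * algebraMap K E.M R →
      psC D (fun i => algebraMap K E.M (algebraMap ℂ K (c i)))
        (fun i => ∏ σ : H, σ.1 (u i)) (∑ σ : H, σ.1 v)
        = Fintype.card H * (ℓ * algebraMap K E.M R) := by
    intro D R hD h
    have h' : ∀ σ : H, psC D (fun i => algebraMap K E.M (algebraMap ℂ K (c i)))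
        (fun i => σ.1 (u i)) (σ.1 v) = ℓ * algebraMap K E.M R := fun σ => by
      have := congrArg σ.1 h
      simpa [psC, hD, hσℓ] using this
    have hsum := Finset.sum_congr (rfl : (Finset.univ : Finset H) = Finset.univ)
      fun σ _ => h' σ
    rw [Finset.sum_const, Finset.card_univ, nsmul_eq_mul] at hsum
    rw [← hsum]
    simp only [psC, Finset.sum_add_distrib, map_sum]
    rw [Finset.sum_comm]
    congr 1
    refine Finset.sum_congr rfl fun i _ => ?_
    rw [deriv_prod_div_prod _ _ _ fun σ _ => by simpa using hu i, Finset.mul_sum]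
  have hX' := key E.DX P (algEquiv_deriv_apply E.extX) hX
  have hY' := key E.DY Q (algEquiv_deriv_apply E.extY) hY
  refine ⟨m, c, fun i => ∏ σ : H, σ.1 (u i), ∑ σ : H, σ.1 v, fun i => ?_, ?_, ?_, ?_, ?_⟩
  · rw [← hfix, IntermediateField.mem_fixedField_iff]
    intro τ hτ
    rw [map_prod]
    exact Fintype.prod_equiv (Equiv.mulLeft ⟨τ, hτ⟩) _ _ fun σ => rfl
  · rw [← hfix, IntermediateField.mem_fixedField_iff]
    intro τ hτ
    rw [map_sum]
    exact Fintype.sum_equiv (Equiv.mulLeft ⟨τ, hτ⟩) _ _ fun σ => rfl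
  · exact fun i => Finset.prod_ne_zero_iff.2 fun σ _ => by simpa using hu i
  · rw [hX', hY']
    ring
  · rw [hX', hY']
    have hcard : (Fintype.card H : E.M) ≠ 0 := by simp
    simp only [ne_eq, mul_eq_zero, hcard, hℓ, false_or, map_eq_zero]
    tauto

end Extension

/-- If every automorphism rescales a generator `a` of a finite Galois extension by an element of
the algebraically closed field `C`, then the extension is a cyclic radical extension. -/
lemma exists_generator_smul_of_forall_smul {C K L : Type} [Field C] [Field K] [Field L]
    [Algebra C K] [Algebra K L] [FiniteDimensional K L] [IsGalois K L] {a : L} (ha : a ≠ 0)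
    (htop : IntermediateField.adjoin K {a} = ⊤)
    (h : ∀ σ : L ≃ₐ[K] L, ∃ z : C, σ a = algebraMap K L (algebraMap C K z) * a) :
    IsCyclic (L ≃ₐ[K] L) ∧ ∃ (ζ : C) (τ : L ≃ₐ[K] L),
      IsPrimitiveRoot ζ (Module.finrank K L) ∧
      (∀ σ : L ≃ₐ[K] L, σ ∈ Subgroup.zpowers τ) ∧
      τ a = algebraMap K L (algebraMap C K ζ) * a ∧
      ∃ k : K, a ^ Module.finrank K L = algebraMap K L k := by
  choose χ hχ using h
  have hinj : Function.Injective fun z : C => algebraMap K L (algebraMap C K z) :=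
    (algebraMap K L).injective.comp (algebraMap C K).injective
  let χ' : (L ≃ₐ[K] L) →* C :=
    { toFun := χ
      map_one' := hinj <| mul_right_cancel₀ ha <| by simp [← hχ]
      map_mul' := fun σ τ => hinj <| mul_right_cancel₀ ha <| by
        simp only [map_mul]
        rw [← hχ, AlgEquiv.mul_apply, hχ τ, map_mul, AlgEquiv.commutes, hχ σ]
        ring }
  have hχ'inj : Function.Injective χ' := by
    intro σ τ hστ
    have hστ : χ σ = χ τ := hστ
    have htop' : Algebra.adjoin K {a} = ⊤ := by
      rw [← IntermediateField.adjoin_simple_toSubalgebra_of_isAlgebraic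
        (Algebra.IsAlgebraic.isAlgebraic a), htop, IntermediateField.top_toSubalgebra]
    have : (σ : L →ₐ[K] L) = τ := AlgHom.ext_of_adjoin_eq_top htop' (by
      intro w hw
      rw [Set.mem_singleton_iff.1 hw]
      change σ a = τ a
      rw [hχ, hχ, hστ])
    exact AlgEquiv.ext fun x => DFunLike.congr_fun this x
  have hcyc : IsCyclic (L ≃ₐ[K] L) := isCyclic_of_injective_ringHom χ' hχ'inj
  obtain ⟨τ, hτ⟩ := hcyc.exists_generator
  have hord : orderOf τ = Module.finrank K L := by
    rw [orderOf_eq_card_of_forall_mem_zpowers hτ, IsGalois.card_aut_eq_finrank]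
  refine ⟨hcyc, χ τ, τ, ?_, hτ, hχ τ, ?_⟩
  · have := IsPrimitiveRoot.orderOf (χ' τ)
    rwa [orderOf_injective χ' hχ'inj, hord] at this
  · have hmem : a ^ Module.finrank K L ∈ Set.range (algebraMap K L) := by
      rw [IsGalois.mem_range_algebraMap_iff_fixed]
      intro σ
      have h1 : χ σ ^ Module.finrank K L = 1 := by
        change χ' σ ^ Module.finrank K L = 1
        rw [← map_pow, ← IsGalois.card_aut_eq_finrank, pow_card_eq_one', map_one]
      rw [map_pow, hχ, mul_pow, ← map_pow, ← map_pow, h1, map_one, map_one, one_mul]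
    obtain ⟨k, hk⟩ := hmem
    exact ⟨k, hk.symm⟩

/-- Proposition `cyclo`. For an exceptional one-form ω over K = ℂ(x,y),
a minimal algebraic extension L over which a Prelle–Singer relation holds is L = K(ℓ),
cyclic Galois over K, and ℓⁿ ∈ K with τ(ℓ) = ζℓ for a generator τ and a primitive
n-th root of unity ζ. -/
theorem exceptional_minimal_extension_cyclic
    {K : Type} [Field K] [CharZero K] [Algebra ℂ K]
    (x y : K) (Dx Dy : Derivation ℚ K K)
    (hxx : Dx x = 1) (hxy : Dx y = 0) (hyx : Dy x = 0) (hyy : Dy y = 1)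
    (hDxC : ∀ z : ℂ, Dx (algebraMap ℂ K z) = 0)
    (hDyC : ∀ z : ℂ, Dy (algebraMap ℂ K z) = 0)
    (hcomm : ∀ a : K, Dx (Dy a) = Dy (Dx a))
    (hgen : IntermediateField.adjoin ℂ {x, y} = ⊤)
    (hind : AlgebraicIndependent ℂ ![x, y])
    (P Q : K) (hω : ¬ (P = 0 ∧ Q = 0))
    (hexc : IsExceptional Dx Dy P Q)
    {E : DiffExt K Dx Dy} (hGal : IsGalois K E.M)
    (m : ℕ) (c : Fin m → ℂ) (u : Fin m → E.M) (v : E.M)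
    (hPS : PSRel E.DX E.DY (algebraMap K E.M P) (algebraMap K E.M Q)
      (fun i => algebraMap K E.M (algebraMap ℂ K (c i))) u v)
    (ℓ : E.M) (hℓ : ℓ ≠ 0)
    (hℓX : psC E.DX (fun i => algebraMap K E.M (algebraMap ℂ K (c i))) u v
      = ℓ * algebraMap K E.M P)
    (hℓY : psC E.DY (fun i => algebraMap K E.M (algebraMap ℂ K (c i))) u v
      = ℓ * algebraMap K E.M Q)
    (L : IntermediateField K E.M) (hmin : Minimal (RelIn E P Q) L) :
    L = IntermediateField.adjoin K {ℓ} ∧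
    IsGalois K L ∧
    IsCyclic (↥L ≃ₐ[K] ↥L) ∧
    Nat.card (↥L ≃ₐ[K] ↥L) = Module.finrank K ↥L ∧
    ∃ (hℓL : ℓ ∈ L) (ζ : ℂ) (τ : ↥L ≃ₐ[K] ↥L),
      IsPrimitiveRoot ζ (Module.finrank K ↥L) ∧
      (∀ σ : ↥L ≃ₐ[K] ↥L, σ ∈ Subgroup.zpowers τ) ∧
      τ ⟨ℓ, hℓL⟩ = algebraMap K ↥L (algebraMap ℂ K ζ) * ⟨ℓ, hℓL⟩ ∧
      ∃ k : K, ℓ ^ (Module.finrank K ↥L) = algebraMap K E.M k := by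
  have := E.finite
  obtain ⟨-, hbase⟩ := hexc
  have hconst : ∀ a, Dx a = 0 → Dy a = 0 → a ∈ (algebraMap ℂ K).range := fun a hax hay =>
    mem_range_algebraMap_of_deriv_eq_zero hxx hyy hxy hyx hDxC hDyC hgen hind hax hay
  have hclosed := closed_of_psC_eq_mul hcomm hDxC hDyC E hPS.1 hℓX hℓY
  have hσ : ∀ σ : E.M ≃ₐ[K] E.M, ∃ z : ℂ, σ ℓ = algebraMap K E.M (algebraMap ℂ K z) * ℓ := by
    intro σ
    refine exists_complex_mul_eq_of_closed hconst hbase E hℓ hclosed ?_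
    have := congrArg σ hclosed
    simpa only [algEquiv_deriv_apply E.extX, algEquiv_deriv_apply E.extY, map_mul,
      AlgEquiv.commutes] using this
  have hℓL : ℓ ∈ L := by
    obtain ⟨m', c', u', v', hu', hv', hPS'⟩ := hmin.prop
    obtain ⟨g, hgL, hg0, hgX, hgY⟩ := exists_eq_mul_of_relIn hω hu' hv' hPS'
    obtain ⟨z, rfl⟩ := exists_complex_mul_eq_of_closed hconst hbase E hg0
      (closed_of_psC_eq_mul hcomm hDxC hDyC E hPS'.1 hgX hgY) hclosed
    exact L.mul_mem (L.algebraMap_mem _) hgL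
  have hL : L = IntermediateField.adjoin K {ℓ} :=
    hmin.eq_of_ge (relIn_adjoin_simple hω hℓ hPS.1 hℓX hℓY)
      (IntermediateField.adjoin_simple_le_iff.2 hℓL)
  have hnormal : Normal K L := by
    rw [IntermediateField.normal_iff_forall_map_le']
    intro σ
    nth_rewrite 1 [hL]
    rw [IntermediateField.adjoin_map, Set.image_singleton,
      IntermediateField.adjoin_simple_le_iff]
    obtain ⟨z, hz⟩ := hσ σ
    change σ ℓ ∈ L
    rw [hz]
    exact L.mul_mem (L.algebraMap_mem _) hℓL
  have hGalL : IsGalois K L := ⟨⟩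
  have htop : IntermediateField.adjoin K {(⟨ℓ, hℓL⟩ : L)} = ⊤ := by
    apply IntermediateField.map_injective L.val
    rw [IntermediateField.adjoin_map, Set.image_singleton, ← AlgHom.fieldRange_eq_map,
      IntermediateField.fieldRange_val]
    exact hL.symm
  obtain ⟨hcyc, ζ, τ, hζ, hτ, hτℓ, k, hk⟩ :=
    exists_generator_smul_of_forall_smul (C := ℂ) (a := (⟨ℓ, hℓL⟩ : L))
      (fun h => hℓ (congrArg Subtype.val h)) htop fun σ => by
        obtain ⟨σ', rfl⟩ := AlgEquiv.restrictNormalHom_surjective (K₁ := L) E.M σ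
        obtain ⟨z, hz⟩ := hσ σ'
        exact ⟨z, Subtype.ext <|
          (AlgEquiv.restrictNormal_commutes σ' L ⟨ℓ, hℓL⟩).trans hz⟩
  exact ⟨hL, hGalL, hcyc, IsGalois.card_aut_eq_finrank K L, hℓL, ζ, τ, hζ, hτ, hτℓ, k,
    congrArg Subtype.val hk⟩
end
end
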